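/- Let K be a field, E a finite set, and W ⊆ K^E a realization of a 3-connected matroid M of rank at least 2. Then the ideal M_W of submaximal minors of the configuration form Q_W is a prime ideal of K[x_e : e ∈ E] (so the second degeneracy scheme Δ_W is integral), and consequently the Jacobian ideal J_W has a unique minimal prime (the Jacobian scheme Σ_W is irreducible). -/

import Mathlib

open scoped BigOperators

namespace Config

variable {K : Type} [Field K] {E : Type} [Fintype E] [DecidableEq E]

/-- `w` is a (linear) basis of the configuration `W ⊆ K^E`. -/
def IsBasisOf {r : ℕ} (w : Fin r → E → K) (W : Submodule K (E → K)) : Prop :=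
  LinearIndependent K w ∧ Submodule.span K (Set.range w) = W

/-- The configuration (bilinear) form `Q_W` computed from the basis `w`: the symmetric
`r × r` matrix with entries `∑_{e ∈ E} x_e · w^i_e · w^j_e` over `K[x_e : e ∈ E]`. -/
noncomputable def Qform {r : ℕ} (w : Fin r → E → K) :
    Matrix (Fin r) (Fin r) (MvPolynomial E K) :=
  Matrix.of fun i j => ∑ e : E, MvPolynomial.C (w i e * w j e) * MvPolynomial.X e

/-- The coefficient `c_{W,B} = (det (w^i_e)_{1≤i≤r, e∈B})²`, the squared determinant of
the `r × r` submatrix of the coefficient matrix of `w` with column set `B` (the square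
is independent of the chosen ordering of the columns). -/
noncomputable def cSq {r : ℕ} (w : Fin r → E → K) (B : Finset E) : K :=
  if h : B.card = r then
    (Matrix.det (Matrix.of fun i j : Fin r =>
      w i ((Finset.equivFinOfCardEq h).symm j : E))) ^ 2
  else 0

/-- The configuration polynomial `ψ_W = ∑_B c_{W,B} · x^B` computed from the basis `w`
(the coefficient `c_{W,B}` vanishes unless `B` is a basis of the matroid `M_W`). -/
noncomputable def psi {r : ℕ} (w : Fin r → E → K) : MvPolynomial E K :=
  ∑ B ∈ Finset.univ.powersetCard r,
    MvPolynomial.C (cSq w B) * ∏ e ∈ B, MvPolynomial.X e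

/-- The ideal `M_W` generated by the submaximal, i.e. `(r−1) × (r−1)`, minors of the
configuration form `Q_W`. -/
noncomputable def minorIdeal {r : ℕ} (w : Fin r → E → K) : Ideal (MvPolynomial E K) :=
  Ideal.span {p | ∃ f g : Fin (r - 1) ↪ Fin r, p = Matrix.det ((Qform w).submatrix f g)}

/-- The Jacobian ideal `J_W = ⟨ψ_W⟩ + ⟨∂ψ_W/∂x_e : e ∈ E⟩`. -/
noncomputable def jacIdeal {r : ℕ} (w : Fin r → E → K) : Ideal (MvPolynomial E K) :=
  Ideal.span ({psi w} ∪ Set.range fun e => MvPolynomial.pderiv e (psi w))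

/-- The rank in `M_W` of a subset `S ⊆ E`: the dimension of the image of `W`
under the projection onto the coordinates in `S`. -/
noncomputable def rkOn (W : Submodule K (E → K)) (S : Finset E) : ℕ :=
  Module.finrank K (W.map (LinearMap.funLeft K K (fun e : {x : E // x ∈ S} => (e : E))))

/-- `S` is a `k`-separation of the matroid `M_W`:
`λ(S) = rk S + rk Sᶜ − rk M < k ≤ min (|S|, |Sᶜ|)`. -/
def KSep (W : Submodule K (E → K)) (k : ℕ) (S : Finset E) : Prop :=
  rkOn W S + rkOn W Sᶜ < rkOn W Finset.univ + k ∧ k ≤ S.card ∧ k ≤ Sᶜ.card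

/-- The matroid `M_W` is 3-connected: it has no 1-separation and no 2-separation. -/
def ThreeConnected (W : Submodule K (E → K)) : Prop :=
  ∀ S : Finset E, ¬ KSep W 1 S ∧ ¬ KSep W 2 S


end Config

namespace Config
section Hom
open CategoryTheory CategoryTheory.Abelian RingTheory.Sequence Pointwise

/-- every prime above `b` has height at least `n` -/
def HtGE {R : Type} [CommRing R] (b : Ideal R) (n : ℕ) : Prop :=
  ∀ P : Ideal R, P.IsPrime → b ≤ P → (n : ℕ∞) ≤ P.height

variable {R : Type} [CommRing R]

/-- vanishing of Ext up to degree `n` -/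
def Dep (X Y : ModuleCat.{0} R) (n : ℕ) : Prop := ∀ i < n, Subsingleton (Ext X Y i)

lemma HtGE.mono {a b : Ideal R} {n : ℕ} (h : HtGE a n) (hab : a ≤ b) : HtGE b n :=
  fun P hP hb => h P hP (hab.trans hb)

lemma HtGE.le {a : Ideal R} {n m : ℕ} (h : HtGE a n) (hm : m ≤ n) : HtGE a m :=
  fun P hP hb => le_trans (by exact_mod_cast hm) (h P hP hb)

lemma Dep.le {X Y : ModuleCat.{0} R} {n m : ℕ} (h : Dep X Y n) (hm : m ≤ n) : Dep X Y m :=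
  fun i hi => h i (by omega)

/-- the short complex attached to an exact sequence of modules -/
def mkSES {A B C : Type} [AddCommGroup A] [AddCommGroup B] [AddCommGroup C]
    [Module R A] [Module R B] [Module R C] (f : A →ₗ[R] B) (g : B →ₗ[R] C)
    (hfg : Function.Exact f g) : ShortComplex (ModuleCat.{0} R) :=
  ShortComplex.mk (ModuleCat.ofHom f) (ModuleCat.ofHom g) (by
    rw [← ModuleCat.ofHom_comp, hfg.linearMap_comp_eq_zero]; rfl)

lemma mkSES_shortExact {A B C : Type} [AddCommGroup A] [AddCommGroup B] [AddCommGroup C]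
    [Module R A] [Module R B] [Module R C] (f : A →ₗ[R] B) (g : B →ₗ[R] C)
    (hf : Function.Injective f) (hg : Function.Surjective g)
    (hfg : Function.Exact f g) : (mkSES f g hfg).ShortExact where
  exact := (ShortComplex.ShortExact.moduleCat_exact_iff_function_exact _).mpr hfg
  mono_f := (ModuleCat.mono_iff_injective _).mpr hf
  epi_g := (ModuleCat.epi_iff_surjective _).mpr hg

variable {A B C : Type} [AddCommGroup A] [AddCommGroup B] [AddCommGroup C]
    [Module R A] [Module R B] [Module R C]

lemma dep_right (X : ModuleCat.{0} R) (f : A →ₗ[R] B) (g : B →ₗ[R] C)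
    (hf : Function.Injective f) (hg : Function.Surjective g)
    (hfg : Function.Exact f g) {n : ℕ} (hA : Dep X (ModuleCat.of R A) (n+1))
    (hB : Dep X (ModuleCat.of R B) n) : Dep X (ModuleCat.of R C) n := by
  intro i hi
  have zero1 := AddCommGrpCat.isZero_of_iff_subsingleton.mpr (hB i hi)
  have zero2 := AddCommGrpCat.isZero_of_iff_subsingleton.mpr (hA (i + 1) (by omega))
  exact AddCommGrpCat.subsingleton_of_isZero <| ShortComplex.Exact.isZero_of_both_zeros
        ((Ext.covariant_sequence_exact₃' X (mkSES_shortExact f g hf hg hfg)) i (i + 1) rfl)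
        (zero1.eq_zero_of_src _) (zero2.eq_zero_of_tgt _)

lemma ext_zero_inj (X : ModuleCat.{0} R) (f : A →ₗ[R] B)
    (hf : Function.Injective f) (hB : Subsingleton (Ext X (ModuleCat.of R B) 0)) :
    Subsingleton (Ext X (ModuleCat.of R A) 0) := by
  have h1 : Subsingleton (X ⟶ ModuleCat.of R B) := Ext.addEquiv₀.subsingleton_congr.mp hB
  have : Mono (ModuleCat.ofHom f) := (ModuleCat.mono_iff_injective _).mpr hf
  refine Ext.addEquiv₀.subsingleton_congr.mpr ⟨fun a b => ?_⟩
  rw [← cancel_mono (ModuleCat.ofHom f)]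
  exact Subsingleton.elim _ _

lemma dep_left (X : ModuleCat.{0} R) (f : A →ₗ[R] B) (g : B →ₗ[R] C)
    (hf : Function.Injective f) (hg : Function.Surjective g)
    (hfg : Function.Exact f g) {n : ℕ} (hB : Dep X (ModuleCat.of R B) (n+1))
    (hC : Dep X (ModuleCat.of R C) n) : Dep X (ModuleCat.of R A) (n+1) := by
  intro i hi
  rcases i with _ | i
  · exact ext_zero_inj X f hf (hB 0 (by omega))
  have zero1 := AddCommGrpCat.isZero_of_iff_subsingleton.mpr (hC i (by omega))
  have zero2 := AddCommGrpCat.isZero_of_iff_subsingleton.mpr (hB (i + 1) (by omega))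
  exact AddCommGrpCat.subsingleton_of_isZero <| ShortComplex.Exact.isZero_of_both_zeros
        ((Ext.covariant_sequence_exact₁' X (mkSES_shortExact f g hf hg hfg)) i (i + 1) rfl)
        (zero1.eq_zero_of_src _) (zero2.eq_zero_of_tgt _)

/-- contravariant middle term -/
lemma dep_contra (Y : ModuleCat.{0} R) (f : A →ₗ[R] B) (g : B →ₗ[R] C)
    (hf : Function.Injective f) (hg : Function.Surjective g)
    (hfg : Function.Exact f g) {n : ℕ} (hA : Dep (ModuleCat.of R A) Y n)
    (hC : Dep (ModuleCat.of R C) Y n) : Dep (ModuleCat.of R B) Y n := by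
  intro i hi
  have zero1 := AddCommGrpCat.isZero_of_iff_subsingleton.mpr (hC i hi)
  have zero2 := AddCommGrpCat.isZero_of_iff_subsingleton.mpr (hA i hi)
  exact AddCommGrpCat.subsingleton_of_isZero <| ShortComplex.Exact.isZero_of_both_zeros
        (Ext.contravariant_sequence_exact₂' (mkSES_shortExact f g hf hg hfg) Y i)
        (zero1.eq_zero_of_src _) (zero2.eq_zero_of_tgt _)

lemma dep_iso {X X' Y Y' : ModuleCat.{0} R} (e : X ≅ X') (e' : Y ≅ Y') {n : ℕ} (h : Dep X Y n) :
    Dep X' Y' n := by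
  intro i hi
  have := h i hi
  constructor
  intro a b
  have key : ∀ a : Ext X' Y' i, a = 0 := by
    intro a
    have h1 : (Ext.mk₀ e.hom).comp (a.comp (Ext.mk₀ e'.inv) (add_zero i)) (zero_add i) = 0 :=
      Subsingleton.elim _ _
    have h2 : a = (Ext.mk₀ e.inv).comp (((Ext.mk₀ e.hom).comp (a.comp (Ext.mk₀ e'.inv) (add_zero i)) (zero_add i)).comp (Ext.mk₀ e'.hom) (add_zero i)) (zero_add i) := by
      simp
    rw [h2, h1]; simp
  rw [key a, key b]

end Hom
end Config


namespace Config
section Hom2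
open CategoryTheory CategoryTheory.Abelian RingTheory.Sequence Pointwise

variable {R : Type} [CommRing R]

lemma dep_shift_down (X M : ModuleCat.{0} R) {s : R} (hs : IsSMulRegular M s) {n : ℕ}
    (h : Dep X M (n+1)) : Dep X (ModuleCat.of R (QuotSMulTop s M)) n := by
  intro i hi
  have zero1 := AddCommGrpCat.isZero_of_iff_subsingleton.mpr (h i (by omega))
  have zero2 := AddCommGrpCat.isZero_of_iff_subsingleton.mpr (h (i + 1) (by omega))
  exact AddCommGrpCat.subsingleton_of_isZero <| ShortComplex.Exact.isZero_of_both_zeros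
        ((Ext.covariant_sequence_exact₃' X hs.smulShortComplex_shortExact) i (i + 1) rfl)
        (zero1.eq_zero_of_src _) (zero2.eq_zero_of_tgt _)

lemma dep_shift_up (X M : ModuleCat.{0} R) {s : R} (hs : IsSMulRegular M s)
    (hX : s ∈ Module.annihilator R X) {n : ℕ}
    (h : Dep X (ModuleCat.of R (QuotSMulTop s M)) n) : Dep X M (n+1) := by
  intro i hi
  match i with
  | 0 =>
    have : Subsingleton (X →ₗ[R] M) := by
      refine ⟨fun a b => LinearMap.ext fun x => hs ?_⟩
      show s • a x = s • b x
      rw [← map_smul, ← map_smul, Module.mem_annihilator.mp hX x, map_zero, map_zero]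
    exact (Ext.addEquiv₀.trans ModuleCat.homAddEquiv).subsingleton
  | i + 1 =>
    let g := (AddCommGrpCat.ofHom ((Ext.mk₀ (ModuleCat.smulShortComplex M s).f).postcomp X
          (add_zero (i + 1))))
    have mono_g : Mono g := by
      apply (Ext.covariant_sequence_exact₁' X hs.smulShortComplex_shortExact i (i + 1)
            rfl).mono_g ((AddCommGrpCat.isZero_of_iff_subsingleton.mpr ?_).eq_zero_of_src _)
      exact h i (by omega)
    have zero_g : g = 0 := Ext.postcomp_smul_id_eq_zero_of_mem_annihilator hX (i + 1)
    exact AddCommGrpCat.subsingleton_of_isZero (Limits.IsZero.of_mono_eq_zero _ zero_g)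

lemma dep_seq (X : ModuleCat.{0} R) (rs : List R) (M : Type) [AddCommGroup M] [Module R M]
    (hX : ∀ s ∈ rs, s ∈ Module.annihilator R X) (hM : IsWeaklyRegular M rs) (n : ℕ) :
    Dep X (ModuleCat.of R (M ⧸ (Ideal.ofList rs • ⊤ : Submodule R M))) n ↔
      Dep X (ModuleCat.of R M) (n + rs.length) := by
  induction rs generalizing M with
  | nil =>
    have e : (M ⧸ (Ideal.ofList ([] : List R) • ⊤ : Submodule R M)) ≃ₗ[R] M :=
      Submodule.quotEquivOfEqBot _ (by rw [Ideal.ofList_nil, Submodule.bot_smul])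
    exact ⟨fun h => dep_iso (Iso.refl _) e.toModuleIso h,
      fun h => dep_iso (Iso.refl _) e.symm.toModuleIso h⟩
  | cons r rs ih =>
    rw [isWeaklyRegular_cons_iff] at hM
    have e := Submodule.quotOfListConsSMulTopEquivQuotSMulTopInner M r rs
    have ih' := ih (QuotSMulTop r M) (fun s hs => hX s (List.mem_cons_of_mem _ hs)) hM.2
    have h1 : Dep X (ModuleCat.of R (M ⧸ (Ideal.ofList (r :: rs) • ⊤ : Submodule R M))) n ↔
        Dep X (ModuleCat.of R (QuotSMulTop r M ⧸ (Ideal.ofList rs • ⊤ : Submodule R (QuotSMulTop r M)))) n :=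
      ⟨fun h => dep_iso (Iso.refl _) e.toModuleIso h,
      fun h => dep_iso (Iso.refl _) e.symm.toModuleIso h⟩
    rw [h1, ih', List.length_cons, ← add_assoc]
    exact ⟨fun h => dep_shift_up X (ModuleCat.of R M) hM.1 (hX r List.mem_cons_self) h,
      fun h => dep_shift_down X (ModuleCat.of R M) hM.1 h⟩

lemma dep_one_iff (a b : Ideal R) :
    Dep (ModuleCat.of R (R ⧸ b)) (ModuleCat.of R (R ⧸ a)) 1 ↔
      ∀ z, (∀ x ∈ b, x * z ∈ a) → z ∈ a := by
  have h0 : Dep (ModuleCat.of R (R ⧸ b)) (ModuleCat.of R (R ⧸ a)) 1 ↔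
      Subsingleton ((R ⧸ b) →ₗ[R] (R ⧸ a)) := by
    have e : Ext (ModuleCat.of R (R ⧸ b)) (ModuleCat.of R (R ⧸ a)) 0 ≃+
      ((R ⧸ b) →ₗ[R] (R ⧸ a)) := Ext.addEquiv₀.trans ModuleCat.homAddEquiv
    rw [← e.toEquiv.subsingleton_congr]
    constructor
    · intro h; exact h 0 (by omega)
    · intro h i hi
      obtain rfl : i = 0 := by omega
      exact h
  rw [h0]
  constructor
  · intro h z hz
    let f : (R ⧸ b) →ₗ[R] (R ⧸ a) := Submodule.liftQ b
      (LinearMap.toSpanSingleton R (R ⧸ a) (Ideal.Quotient.mk a z)) (by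
        intro x hx
        rw [LinearMap.mem_ker, LinearMap.toSpanSingleton_apply]
        have := hz x hx
        rw [← Ideal.Quotient.eq_zero_iff_mem, map_mul] at this
        rw [← this]; rfl)
    have h1 : f (Ideal.Quotient.mk b 1) = 0 := by
      rw [Subsingleton.elim f 0]; rfl
    have h2 : f (Ideal.Quotient.mk b 1) = Ideal.Quotient.mk a z := by
      show (1 : R) • Ideal.Quotient.mk a z = _
      rw [one_smul]
    rw [h2] at h1
    exact Ideal.Quotient.eq_zero_iff_mem.mp h1
  · intro h
    have key : ∀ f : (R ⧸ b) →ₗ[R] (R ⧸ a), f = 0 := by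
      intro f
      obtain ⟨z, hz⟩ := Ideal.Quotient.mk_surjective (f (Ideal.Quotient.mk b 1))
      have hz' : z ∈ a := by
        apply h z
        intro x hx
        rw [← Ideal.Quotient.eq_zero_iff_mem, map_mul, hz]
        have : (Ideal.Quotient.mk a x) * f (Ideal.Quotient.mk b 1)
          = f (x • Ideal.Quotient.mk b 1) := by rw [map_smul]; rfl
        rw [this]
        have : x • Ideal.Quotient.mk b 1 = 0 := by
          have : x • Ideal.Quotient.mk b 1 = Ideal.Quotient.mk b (x * 1) := rfl
          rw [this, mul_one, Ideal.Quotient.eq_zero_iff_mem.mpr hx]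
        rw [this, map_zero]
      rw [Ideal.Quotient.eq_zero_iff_mem.mpr hz'] at hz
      ext
      exact hz.symm
    exact ⟨fun f g => by rw [key f, key g]⟩

/-- grade at least height, for primes -/
def CMprop (R : Type) [CommRing R] : Prop :=
  ∀ P : Ideal R, P.IsPrime → ∀ n : ℕ, (n : ℕ∞) ≤ P.height →
    ∃ rs : List R, rs.length = n ∧ (∀ r ∈ rs, r ∈ P) ∧ IsWeaklyRegular R rs

lemma CMprop.dep_prime (h : CMprop R) (P : Ideal R) (hP : P.IsPrime) (n : ℕ)
    (hn : (n : ℕ∞) ≤ P.height) : Dep (ModuleCat.of R (R ⧸ P)) (ModuleCat.of R R) n := by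
  obtain ⟨rs, hl, hm, hr⟩ := h P hP n hn
  have := (dep_seq (ModuleCat.of R (R ⧸ P)) rs R (fun s hs => by
    rw [Ideal.annihilator_quotient]; exact hm s hs) hr 0).mp (fun i hi => by omega)
  rwa [zero_add, hl] at this

lemma CMprop.dep_mod [IsNoetherianRing R] (h : CMprop R) (n : ℕ) (M : Type) [AddCommGroup M] [Module R M]
    (hfin : Module.Finite R M)
    (hM : ∀ P ∈ Module.support R M, (n : ℕ∞) ≤ P.asIdeal.height) :
    Dep (ModuleCat.of R M) (ModuleCat.of R R) n := by
  revert hM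
  induction hfin using IsNoetherianRing.induction_on_isQuotientEquivQuotientPrime R with
  | subsingleton N =>
    intro _
    have h0 : Dep (ModuleCat.of R (R ⧸ (⊤ : Ideal R))) (ModuleCat.of R R) n := by
      intro i hi
      have hz : Limits.IsZero (ModuleCat.of R (R ⧸ (⊤ : Ideal R))) := by
        apply ModuleCat.isZero_of_iff_subsingleton.mpr
        exact Ideal.Quotient.subsingleton_iff.mpr rfl
      exact ⟨fun a b => by
        have : ∀ a : Ext (ModuleCat.of R (R ⧸ (⊤ : Ideal R))) (ModuleCat.of R R) i, a = 0 := by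
          intro a
          rw [← Ext.mk₀_id_comp a, hz.eq_of_src (𝟙 _) 0, Ext.mk₀_zero, Ext.zero_comp]
        rw [this a, this b]⟩
    have : Subsingleton (R ⧸ (⊤ : Ideal R)) := Ideal.Quotient.subsingleton_iff.mpr rfl
    have e : (R ⧸ (⊤ : Ideal R)) ≃ₗ[R] N :=
      { toFun := fun _ => 0, invFun := fun _ => 0, map_add' := by simp, map_smul' := by simp,
        left_inv := fun _ => Subsingleton.elim _ _, right_inv := fun _ => Subsingleton.elim _ _ }
    exact dep_iso e.toModuleIso (Iso.refl _) h0
  | quotient N p f =>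
    intro hM
    refine dep_iso f.symm.toModuleIso (Iso.refl _) (h.dep_prime p.asIdeal p.2 n (hM p ?_))
    rw [f.support_eq, Module.support_eq_zeroLocus, Ideal.annihilator_quotient]
    exact le_refl p.asIdeal
  | exact N₁ N₂ N₃ f g hf hg hfg h₁ h₃ =>
    intro hM
    rw [Module.support_of_exact hfg hf hg] at hM
    exact dep_contra _ f g hf hg hfg (h₁ fun P hP => hM P (Or.inl hP))
      (h₃ fun P hP => hM P (Or.inr hP))

lemma CMprop.dep [IsNoetherianRing R] (h : CMprop R) (n : ℕ) (b : Ideal R) (hb : HtGE b n) :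
    Dep (ModuleCat.of R (R ⧸ b)) (ModuleCat.of R R) n := by
  refine h.dep_mod n (R ⧸ b) inferInstance fun P hP => hb _ P.2 ?_
  rw [Module.support_eq_zeroLocus, Ideal.annihilator_quotient] at hP
  exact hP

lemma CMprop.of_equiv {S : Type} [CommRing S] (e : R ≃+* S) (h : CMprop R) : CMprop S := by
  intro P hP n hn
  obtain ⟨rs, hl, hm, hr⟩ := h (P.comap e) inferInstance n (by rwa [e.height_comap])
  refine ⟨rs.map e, by simpa using hl, ?_, ?_⟩
  · intro r hr
    obtain ⟨s, hs, rfl⟩ := List.mem_map.mp hr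
    exact hm s hs
  · refine (AddEquiv.isWeaklyRegular_congr (e := e.toAddEquiv) ?_).mp hr
    rw [List.forall₂_map_right_iff, List.forall₂_same]
    intro r _ x
    simp

lemma CMprop.field (K : Type) [Field K] : CMprop K := by
  intro P hP n hn
  have : P = ⊥ := (Ideal.eq_bot_or_top P).resolve_right hP.ne_top
  subst this
  rw [Ideal.height_bot] at hn
  obtain rfl : n = 0 := by simpa using hn
  exact ⟨[], rfl, by simp, IsWeaklyRegular.nil _ _⟩

end Hom2
end Config


namespace Config
section Poly
open RingTheory.Sequence Polynomial

attribute [local instance] Polynomial.algebra Polynomial.isLocalization in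
lemma height_le_one_of_comap_bot {D : Type} [CommRing D] [IsDomain D] (P : Ideal D[X])
    [hP : P.IsPrime] (h : P.comap C = ⊥) : P.height ≤ 1 := by
  let F := FractionRing D
  have disj : Disjoint ((nonZeroDivisors D).map C : Set D[X]) P := by
    refine Set.disjoint_left.mpr fun a ⟨b, hb⟩ ha ↦ ?_
    have : b ∈ P.comap C := by rw [Ideal.mem_comap, hb.2]; exact ha
    rw [h, Ideal.mem_bot] at this
    exact nonZeroDivisors.ne_zero hb.1 this
  have eq2 : P.height = (P.map (algebraMap D[X] F[X])).height := by
    rw [IsLocalization.height_map_of_disjoint (Submonoid.map C <| nonZeroDivisors D) _ disj]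
  have hpr : (P.map (algebraMap D[X] F[X])).IsPrime :=
    IsLocalization.isPrime_of_isPrime_disjoint (Submonoid.map C <| nonZeroDivisors D) _ _ hP disj
  rw [eq2]
  by_cases hb : P.map (algebraMap D[X] F[X]) = ⊥
  · rw [hb, Ideal.height_bot]; exact zero_le_one
  · have := hpr.isMaximal hb
    exact (IsPrincipalIdealRing.height_eq_one_of_isMaximal _ (Polynomial.not_isField F)).le

variable {R : Type} [CommRing R] [IsNoetherianRing R]

lemma height_poly_le (P : Ideal R[X]) [hP : P.IsPrime] :
    P.height ≤ (P.comap C).height + 1 := by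
  set q : Ideal R := P.comap C with hq
  have : P.LiesOver q := ⟨rfl⟩
  refine (Ideal.height_le_height_add_of_liesOver q P).trans ?_
  gcongr
  let e : (R[X] ⧸ (q.map (algebraMap R R[X]))) ≃+* (R ⧸ q)[X] :=
    (Ideal.polynomialQuotientEquivQuotientPolynomial q).symm
  rw [← e.height_map]
  have h1 : (P.map (Ideal.Quotient.mk <| q.map (algebraMap R R[X]))).IsPrime := by
    refine Ideal.map_isPrime_of_surjective Ideal.Quotient.mk_surjective ?_
    rw [Ideal.mk_ker]
    exact Ideal.map_comap_le
  have h2 : (Ideal.map e (P.map (Ideal.Quotient.mk <| q.map (algebraMap R R[X])))).IsPrime :=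
    Ideal.map_isPrime_of_equiv e
  apply height_le_one_of_comap_bot
  rw [eq_bot_iff]
  intro x hx
  obtain ⟨x, rfl⟩ := Ideal.Quotient.mk_surjective x
  rw [Ideal.mem_comap] at hx
  rw [Ideal.mem_bot, Ideal.Quotient.eq_zero_iff_mem, hq, Ideal.mem_comap]
  have h3 : C (Ideal.Quotient.mk q x) = e (Ideal.Quotient.mk _ (C x)) := by
    simp [e]
  rw [h3] at hx
  have h4 := (Ideal.mem_map_of_equiv e _).mp hx
  obtain ⟨y, hy, hye⟩ := h4
  have h5 := e.injective hye
  rw [h5, Ideal.mem_quotient_iff_mem] at hy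
  · exact hy
  · exact Ideal.map_comap_le

lemma height_poly_le_of_eq (P : Ideal R[X]) [hP : P.IsPrime] (h : P = (P.comap C).map C) :
    P.height ≤ (P.comap C).height := by
  set q : Ideal R := P.comap C with hq
  have : P.LiesOver q := ⟨rfl⟩
  refine (Ideal.height_le_height_add_of_liesOver q P).trans ?_
  have h1 : P.map (Ideal.Quotient.mk <| q.map (algebraMap R R[X])) = ⊥ := by
    rw [Ideal.map_eq_bot_iff_le_ker, Ideal.mk_ker]
    exact h.le
  have : (q.map (algebraMap R R[X])).IsPrime := by
    show (q.map C).IsPrime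
    rw [← h]; exact hP
  rw [h1, Ideal.height_bot, add_zero]

lemma exists_lead_notMem (J : Ideal R) (A : Ideal R[X]) (hA : J.map C ≤ A) (hne : ¬ A ≤ J.map C) :
    ∃ t ∈ A, t.leadingCoeff ∉ J := by
  obtain ⟨t0, ht0, ht0'⟩ := Set.not_subset.mp hne
  suffices H : ∀ n, ∀ t : R[X], t.natDegree ≤ n → t ∈ A → t ∉ J.map C → ∃ t ∈ A, t.leadingCoeff ∉ J from
    H _ t0 le_rfl ht0 ht0'
  intro n
  induction n with
  | zero =>
    intro t hn ht ht'
    refine ⟨t, ht, fun h => ht' ?_⟩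
    rw [Polynomial.eq_C_of_natDegree_le_zero hn] at h ⊢
    rw [leadingCoeff_C] at h
    exact Ideal.mem_map_of_mem _ h
  | succ n ih =>
    intro t hn ht ht'
    by_cases hl : t.leadingCoeff ∈ J
    · have hm : monomial t.natDegree t.leadingCoeff ∈ J.map C := by
        rw [← C_mul_X_pow_eq_monomial]
        exact Ideal.mul_mem_right _ _ (Ideal.mem_map_of_mem _ hl)
      have he := t.eraseLead_add_monomial_natDegree_leadingCoeff
      refine ih t.eraseLead ?_ ?_ ?_
      · have := t.eraseLead_natDegree_le; omega
      · rw [← he] at ht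
        exact (A.add_mem_iff_left (hA hm)).mp ht
      · intro h
        exact ht' (he ▸ Ideal.add_mem _ h hm)
    · exact ⟨t, ht, hl⟩

lemma ofList_map_poly (rs : List R) :
    Ideal.ofList (rs.map (algebraMap R R[X])) = (Ideal.ofList rs).map C := by
  rw [← Ideal.map_ofList]; rfl

lemma CMprop.poly (h : CMprop R) : CMprop R[X] := by
  intro P hP n hn
  set q : Ideal R := P.comap C with hq
  have hqP : q.map C ≤ P := Ideal.map_comap_le
  have hqp : q.IsPrime := inferInstance
  have easy : (n : ℕ∞) ≤ q.height → ∃ rs : List R[X], rs.length = n ∧ (∀ r ∈ rs, r ∈ P) ∧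
      IsWeaklyRegular R[X] rs := by
    intro h1
    obtain ⟨rs, hl, hm, hr⟩ := h q inferInstance n h1
    refine ⟨rs.map (algebraMap R R[X]), by simpa using hl, ?_, hr.of_flat⟩
    intro r hr
    obtain ⟨s, hs, rfl⟩ := List.mem_map.mp hr
    exact hm s hs
  by_cases heq : P ≤ q.map C
  · exact easy (hn.trans (height_poly_le_of_eq P (le_antisymm heq hqP)))
  rcases n with _ | m
  · exact ⟨[], rfl, by simp, IsWeaklyRegular.nil _ _⟩
  by_cases hqh : ((m + 1 : ℕ) : ℕ∞) ≤ q.height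
  · exact easy hqh
  have hm : (m : ℕ∞) ≤ q.height := by
    have := hn.trans (height_poly_le P)
    push_cast at this
    exact (ENat.add_le_add_iff_right ENat.one_ne_top).mp this
  obtain ⟨rs, hl, hmem, hr⟩ := h q inferInstance m hm
  obtain ⟨t, htP, htc⟩ := exists_lead_notMem q P hqP heq
  -- the colon condition in R
  have hcol : ∀ z : R, (∀ x ∈ q ⊔ Ideal.span {t.leadingCoeff}, x * z ∈ Ideal.ofList rs) →
      z ∈ Ideal.ofList rs := by
    have hht : HtGE (q ⊔ Ideal.span {t.leadingCoeff}) (m + 1) := by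
      intro Q hQ hle
      have hlt : q < Q := by
        refine lt_of_le_of_ne (le_sup_left.trans hle) ?_
        rintro rfl
        exact htc (hle (Ideal.mem_sup_right (Ideal.mem_span_singleton_self _)))
      calc ((m + 1 : ℕ) : ℕ∞) = m + 1 := by push_cast; rfl
        _ ≤ q.height + 1 := by gcongr
        _ ≤ _ := Ideal.height_add_one_le_of_lt_of_isPrime hlt
    have h1 := h.dep (m+1) _ hht
    rw [add_comm, ← hl] at h1
    have h2 := (dep_seq _ rs R (fun s hs => by
      rw [Ideal.annihilator_quotient]; exact Ideal.mem_sup_left (hmem s hs)) hr 1).mpr h1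
    rw [Ideal.smul_eq_mul, Ideal.mul_top] at h2
    exact (dep_one_iff _ _).mp h2
  -- the colon condition in R[X]
  have hcol2 : ∀ z : R[X], (∀ x ∈ P, x * z ∈ (Ideal.ofList rs).map C) → z ∈ (Ideal.ofList rs).map C := by
    set a := Ideal.ofList rs with ha
    have haq : a ≤ q := by
      rw [ha, Ideal.ofList, Ideal.span_le]
      intro x hx
      exact hmem x hx
    by_contra hcon
    push Not at hcon
    obtain ⟨z0, hz0, hz0'⟩ := hcon
    let A : Ideal R[X] := Submodule.colon (a.map C) (P : Set R[X])
    have hAmem : ∀ z, z ∈ A ↔ ∀ x ∈ P, x * z ∈ a.map C := by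
      intro z
      rw [Submodule.mem_colon]
      simp only [smul_eq_mul, mul_comm z]
      rfl
    obtain ⟨z, hzA, hzl⟩ := exists_lead_notMem a A
      (fun x hx => (hAmem x).mpr fun y _ => Ideal.mul_mem_left _ _ hx)
      (fun h => hz0' (h ((hAmem z0).mpr hz0)))
    rw [hAmem] at hzA
    apply hzl
    apply hcol
    intro x hx
    obtain ⟨y, hy, w, hw, rfl⟩ := Submodule.mem_sup.mp hx
    obtain ⟨c, rfl⟩ := Ideal.mem_span_singleton'.mp hw
    rw [add_mul]
    refine Ideal.add_mem _ ?_ ?_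
    · have := Ideal.mem_map_C_iff.mp (hzA (C y) hy) z.natDegree
      rwa [coeff_C_mul] at this
    · rw [mul_assoc]
      refine Ideal.mul_mem_left _ _ ?_
      have := Ideal.mem_map_C_iff.mp (hzA t htP) (t.natDegree + z.natDegree)
      rwa [coeff_mul_degree_add_degree] at this
  have hdep : Dep (ModuleCat.of R[X] (R[X] ⧸ P)) (ModuleCat.of R[X] R[X]) (m+1) := by
    have h1 := (dep_seq (ModuleCat.of R[X] (R[X] ⧸ P)) (rs.map (algebraMap R R[X])) R[X]
      (fun s hs => by
        rw [Ideal.annihilator_quotient]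
        obtain ⟨s, hs', rfl⟩ := List.mem_map.mp hs
        exact hmem s hs') hr.of_flat 1)
    rw [Ideal.smul_eq_mul, Ideal.mul_top, ofList_map_poly, List.length_map, hl, add_comm 1 m] at h1
    exact h1.mp ((dep_one_iff _ _).mpr hcol2)
  obtain ⟨rs', h1, h2, h3⟩ := ModuleCat.exists_isRegular_of_exists_subsingleton_ext P (m+1)
    (ModuleCat.of R[X] R[X]) (by
      show P • (⊤ : Ideal R[X]) < ⊤
      rw [Ideal.smul_eq_mul, Ideal.mul_top]; exact hP.ne_top.lt_top)
    (ModuleCat.of R[X] (R[X] ⧸ P)) (by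
      rw [Module.support_eq_zeroLocus, Ideal.annihilator_quotient]) hdep
  exact ⟨rs', h1, h2, h3.toIsWeaklyRegular⟩

lemma CMprop.mvPolynomial (K : Type) [Field K] (E : Type) [Finite E] :
    CMprop (MvPolynomial E K) := by
  induction E using Finite.induction_empty_option with
  | of_equiv e H => exact CMprop.of_equiv (MvPolynomial.renameEquiv K e).toRingEquiv H
  | h_empty => exact CMprop.of_equiv (MvPolynomial.isEmptyAlgEquiv K PEmpty).symm.toRingEquiv (CMprop.field K)
  | h_option IH =>
    exact CMprop.of_equiv (MvPolynomial.optionEquivLeft K _).symm.toRingEquiv IH.poly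

end Poly
end Config


namespace Config
section GGsec
open CategoryTheory CategoryTheory.Abelian

variable {R : Type} [CommRing R]

/-- grade condition on the quotient by `a` -/
def GG (k : ℕ) (a : Ideal R) : Prop := ∀ (b : Ideal R) (n : ℕ), HtGE b (n + k) →
  Dep (ModuleCat.of R (R ⧸ b)) (ModuleCat.of R (R ⧸ a)) n

lemma GG_bot [IsNoetherianRing R] (h : CMprop R) : GG 0 (⊥ : Ideal R) := by
  intro b n hb
  exact dep_iso (Iso.refl _) (AlgEquiv.quotientBot R R).symm.toLinearEquiv.toModuleIso (h.dep n b hb)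

lemma GG_principal [IsNoetherianRing R] [IsDomain R] (h : CMprop R) (θ : R) (hθ : θ ≠ 0) :
    GG 1 (Ideal.span {θ}) := by
  intro b n hb
  refine dep_right (A := R) (B := R) (C := R ⧸ Ideal.span {θ}) _ (LinearMap.mulLeft R θ) (Submodule.mkQ (Ideal.span {θ})) ?_
    (Submodule.mkQ_surjective _) ?_ (h.dep (n+1) b hb) (h.dep n b (hb.le (by omega)))
  · exact mul_right_injective₀ hθ
  · intro x
    rw [← LinearMap.mem_ker, Submodule.ker_mkQ, Ideal.mem_span_singleton]
    constructor
    · rintro ⟨c, rfl⟩; exact ⟨c, rfl⟩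
    · rintro ⟨c, rfl⟩; exact ⟨c, rfl⟩

lemma GG_top (k : ℕ) (a : Ideal R) (ha : a = ⊤) : GG k a := by
  intro b n hb i hi
  have hz : Limits.IsZero (ModuleCat.of R (R ⧸ a)) := by
    apply ModuleCat.isZero_of_iff_subsingleton.mpr
    exact Ideal.Quotient.subsingleton_iff.mpr ha
  exact ⟨fun x y => by
    have : ∀ x : Ext (ModuleCat.of R (R ⧸ b)) (ModuleCat.of R (R ⧸ a)) i, x = 0 := by
      intro x
      rw [← Ext.comp_mk₀_id x, hz.eq_of_src (𝟙 _) 0, Ext.mk₀_zero, Ext.comp_zero]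
    rw [this x, this y]⟩

lemma GG.colon {k : ℕ} {a : Ideal R} (h : GG k a) {b : Ideal R} (hb : HtGE b (k+1)) (z : R)
    (hz : ∀ x ∈ b, x * z ∈ a) : z ∈ a :=
  (dep_one_iff a b).mp (h b 1 (by rwa [add_comm])) z hz

lemma GG.colon_span {k : ℕ} {a : Ideal R} (h : GG k a) {s : Set R} (hb : HtGE (Ideal.span s) (k+1))
    (z : R) (hz : ∀ x ∈ s, z * x ∈ a) : z ∈ a := by
  refine h.colon hb z fun x hx => ?_
  induction hx using Submodule.span_induction with
  | mem x hx => rw [mul_comm]; exact hz x hx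
  | zero => rw [zero_mul]; exact a.zero_mem
  | add x y _ _ hx hy => rw [add_mul]; exact a.add_mem hx hy
  | smul c x _ hx => rw [smul_eq_mul, mul_assoc]; exact a.mul_mem_left _ hx

variable {ι : Type}

/-- the map to the quotient attached to a family -/
noncomputable def famMap (J : Ideal R) (a : ι → R) : (ι →₀ R) →ₗ[R] (R ⧸ J) :=
  Finsupp.linearCombination R (fun i => Submodule.Quotient.mk (p := J) (a i))

lemma famMap_apply (J : Ideal R) (a : ι → R) (c : ι →₀ R) :
    famMap J a c = Ideal.Quotient.mk J (c.sum fun i x => x * a i) := by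
  rw [famMap, Finsupp.linearCombination_apply, map_finsuppSum]
  rfl

lemma famMap_ker (J : Ideal R) (a b : ι → R) (hab : ∀ i j, a i * b j - a j * b i ∈ J)
    (ha : ∀ c, (∀ i, c * a i ∈ J) → c ∈ J) : (famMap J a).ker ≤ (famMap J b).ker := by
  intro c hc
  rw [LinearMap.mem_ker, famMap_apply, Ideal.Quotient.eq_zero_iff_mem] at hc ⊢
  apply ha
  intro j
  have h1 : (c.sum fun i x => x * b i) * a j = b j * (c.sum fun i x => x * a i)
      - c.sum fun i x => x * (a i * b j - a j * b i) := by
    rw [Finsupp.sum, Finsupp.sum, Finsupp.sum, Finset.sum_mul, Finset.mul_sum, ← Finset.sum_sub_distrib]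
    exact Finset.sum_congr rfl fun i _ => by ring
  rw [h1]
  refine J.sub_mem (J.mul_mem_left _ hc) (Ideal.sum_mem _ fun i _ => J.mul_mem_left _ (hab _ _))

lemma fam_exact (J : Ideal R) (a : ι → R) (k : Submodule R (ι →₀ R)) (hk : k = (famMap J a).ker) :
    ∃ (f : ((ι →₀ R) ⧸ k) →ₗ[R] (R ⧸ J)) (g : (R ⧸ J) →ₗ[R] (R ⧸ (J ⊔ Ideal.span (Set.range a)))),
      Function.Injective f ∧ Function.Surjective g ∧ Function.Exact f g := by
  subst hk
  refine ⟨(famMap J a).ker.liftQ (famMap J a) le_rfl, Submodule.factor le_sup_left, ?_, ?_, ?_⟩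
  · rw [← LinearMap.ker_eq_bot]; exact Submodule.ker_liftQ_eq_bot _ _ _ le_rfl
  · exact Submodule.factor_surjective _
  · rw [LinearMap.exact_iff, Submodule.range_liftQ]
    ext x
    obtain ⟨x, rfl⟩ := Ideal.Quotient.mk_surjective x
    have h1 : (Ideal.Quotient.mk J x) ∈ (Submodule.factor (le_sup_left : J ≤ J ⊔ Ideal.span (Set.range a))).ker ↔
      x ∈ J ⊔ Ideal.span (Set.range a) := by
      rw [LinearMap.mem_ker]
      exact Ideal.Quotient.eq_zero_iff_mem (I := J ⊔ Ideal.span (Set.range a))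
    rw [h1, LinearMap.mem_range]
    constructor
    · intro h
      obtain ⟨y, hy, z, hz, rfl⟩ := Submodule.mem_sup.mp h
      obtain ⟨c, hc⟩ := Finsupp.mem_span_range_iff_exists_finsupp.mp hz
      refine ⟨c, ?_⟩
      rw [famMap_apply, ← hc]; simp only [smul_eq_mul]; rw [map_add, Ideal.Quotient.eq_zero_iff_mem.mpr hy, zero_add]
    · rintro ⟨c, hc⟩
      rw [famMap_apply] at hc
      have h2 := (Ideal.Quotient.eq.mp hc.symm)
      have h3 : x = (x - c.sum fun i y => y * a i) + c.sum fun i y => y * a i := by ring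
      rw [h3]
      exact Submodule.add_mem_sup h2 (Ideal.sum_mem _ fun i _ => Ideal.mul_mem_left _ _ (Ideal.subset_span ⟨i, rfl⟩))

lemma GG.transfer {k : ℕ} (J : Ideal R) (a b : ι → R) (hab : ∀ i j, a i * b j - a j * b i ∈ J)
    (ha : ∀ c, (∀ i, c * a i ∈ J) → c ∈ J) (hb : ∀ c, (∀ i, c * b i ∈ J) → c ∈ J)
    (hJ : GG k J) (hA : GG (k+1) (J ⊔ Ideal.span (Set.range a))) :
    GG (k+1) (J ⊔ Ideal.span (Set.range b)) := by
  have hker : (famMap J a).ker = (famMap J b).ker := by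
    refine le_antisymm (famMap_ker J a b hab ha) (famMap_ker J b a (fun i j => ?_) hb)
    have h := hab j i
    have : b i * a j - b j * a i = a j * b i - a i * b j := by ring
    rw [this]; exact h
  obtain ⟨f, g, hf, hg, hfg⟩ := fam_exact J a _ rfl
  obtain ⟨f', g', hf', hg', hfg'⟩ := fam_exact J b _ hker
  intro c n hc
  have h1 : Dep (ModuleCat.of R (R ⧸ c)) (ModuleCat.of R (R ⧸ J)) (n+1) :=
    hJ c (n+1) (by rwa [add_assoc, add_comm 1 k])
  have h2 := dep_left _ f g hf hg hfg h1 (hA c n hc)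
  exact dep_right _ f' g' hf' hg' hfg' h2 (h1.le (by omega))

end GGsec
end Config


namespace Config
section Aff
open MvPolynomial

variable {K : Type} [Field K] {E : Type} [DecidableEq E]

/-- substitution `x_e = 0` -/
noncomputable def sg (e : E) : MvPolynomial E K →ₐ[K] MvPolynomial E K :=
  aeval (fun g => if g = e then 0 else X g)

/-- not involving `x_e` -/
def Free (e : E) (p : MvPolynomial E K) : Prop := sg e p = p

/-- affine in `x_e` -/
def Aff (e : E) (p : MvPolynomial E K) : Prop :=
  Free e (pderiv e p) ∧ p = X e * pderiv e p + sg e p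

/-- multi-affine -/
def MA (p : MvPolynomial E K) : Prop := ∀ e, Aff e p

@[simp] lemma sg_X_self (e : E) : sg e (X e : MvPolynomial E K) = 0 := by simp [sg]
lemma sg_X_ne {e f : E} (h : f ≠ e) : sg e (X f : MvPolynomial E K) = X f := by simp [sg, h]
@[simp] lemma sg_C (e : E) (c : K) : sg e (C c) = C c := by simp [sg, MvPolynomial.algebraMap_eq]

lemma sg_sg (e : E) (p : MvPolynomial E K) : sg e (sg e p) = sg e p := by
  induction p using MvPolynomial.induction_on with
  | C a => simp
  | add p q hp hq => simp [hp, hq]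
  | mul_X p f hp =>
    rw [map_mul, map_mul, hp]
    by_cases h : f = e
    · subst h; simp
    · rw [sg_X_ne h, sg_X_ne h]

lemma sg_comm (e f : E) (p : MvPolynomial E K) : sg e (sg f p) = sg f (sg e p) := by
  induction p using MvPolynomial.induction_on with
  | C a => simp
  | add p q hp hq => simp [hp, hq]
  | mul_X p g hp =>
    rw [map_mul, map_mul, hp, map_mul, map_mul]
    by_cases h : g = e
    · subst h
      by_cases h' : g = f
      · subst h'; simp
      · rw [sg_X_ne h']; simp
    · by_cases h' : g = f
      · subst h'; rw [sg_X_ne h]; simp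
      · rw [sg_X_ne h', sg_X_ne h, sg_X_ne h']

lemma pderiv_sg (e : E) (p : MvPolynomial E K) : pderiv e (sg e p) = 0 := by
  induction p using MvPolynomial.induction_on with
  | C a => simp
  | add p q hp hq => simp [hp, hq]
  | mul_X p f hp =>
    rw [map_mul, pderiv_mul, hp]
    by_cases h : f = e
    · subst h; simp
    · rw [sg_X_ne h, pderiv_X_of_ne h]; simp

lemma pderiv_sg_ne {e f : E} (hfe : f ≠ e) (p : MvPolynomial E K) :
    pderiv f (sg e p) = sg e (pderiv f p) := by
  induction p using MvPolynomial.induction_on with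
  | C a => simp
  | add p q hp hq => simp [hp, hq]
  | mul_X p g hp =>
    rw [map_mul, pderiv_mul, hp, pderiv_mul, map_add, map_mul, map_mul]
    by_cases h : g = e
    · subst h; rw [pderiv_X_of_ne hfe.symm]; simp
    · rw [sg_X_ne h]
      by_cases h' : g = f
      · subst h'; simp
      · rw [pderiv_X_of_ne h']; simp

lemma pd_comm (e f : E) (p : MvPolynomial E K) :
    pderiv e (pderiv f p) = pderiv f (pderiv e p) := by
  induction p using MvPolynomial.induction_on with
  | C a => simp
  | add p q hp hq => simp [hp, hq]
  | mul_X p g hp =>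
    simp only [pderiv_mul, map_add, hp, pderiv_X]
    rcases eq_or_ne g e with rfl | h <;> rcases eq_or_ne g f with rfl | h' <;>
      simp [Pi.single_apply, *] <;> try ring

lemma Free.pd {e : E} {p : MvPolynomial E K} (h : Free e p) : pderiv e p = 0 := by
  rw [← h, pderiv_sg]

lemma free_sg (e : E) (p : MvPolynomial E K) : Free e (sg e p) := sg_sg e p
lemma Free.zero (e : E) : Free e (0 : MvPolynomial E K) := map_zero _
lemma Free.one (e : E) : Free e (1 : MvPolynomial E K) := map_one _
lemma Free.C (e : E) (c : K) : Free e (C c : MvPolynomial E K) := sg_C _ _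
lemma Free.X {e f : E} (h : f ≠ e) : Free e (X f : MvPolynomial E K) := sg_X_ne h
lemma Free.add {e : E} {p q : MvPolynomial E K} (hp : Free e p) (hq : Free e q) : Free e (p + q) := by
  rw [Free, map_add, hp, hq]
lemma Free.sub {e : E} {p q : MvPolynomial E K} (hp : Free e p) (hq : Free e q) : Free e (p - q) := by
  rw [Free, map_sub, hp, hq]
lemma Free.mul {e : E} {p q : MvPolynomial E K} (hp : Free e p) (hq : Free e q) : Free e (p * q) := by
  rw [Free, map_mul, hp, hq]
lemma Free.sum {e : E} {ι : Type*} {s : Finset ι} {p : ι → MvPolynomial E K}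
    (hp : ∀ i ∈ s, Free e (p i)) : Free e (∑ i ∈ s, p i) := by
  rw [Free, map_sum]; exact Finset.sum_congr rfl hp
lemma Free.pderiv {e : E} (f : E) {p : MvPolynomial E K} (h : Free e p) : Free e (pderiv f p) := by
  by_cases hfe : f = e
  · subst hfe; rw [h.pd]; exact Free.zero f
  · rw [Free, ← pderiv_sg_ne hfe, h]

lemma aff_of {e : E} {B C : MvPolynomial E K} (hB : Free e B) (hC : Free e C) :
    pderiv e (X e * B + C) = B ∧ sg e (X e * B + C) = C := by
  constructor
  · rw [map_add, pderiv_mul, hC.pd, hB.pd, pderiv_X_self]; ring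
  · rw [map_add, map_mul, hC, sg_X_self]; ring

lemma aff_of' {e : E} {p B C : MvPolynomial E K} (hB : Free e B) (hC : Free e C)
    (h : p = X e * B + C) : Aff e p ∧ MvPolynomial.pderiv e p = B := by
  have := aff_of hB hC
  rw [← h] at this
  refine ⟨⟨by rw [this.1]; exact hB, by rw [this.1, this.2]; exact h⟩, this.1⟩

lemma Free.aff {e : E} {p : MvPolynomial E K} (h : Free e p) : Aff e p :=
  ⟨by rw [h.pd]; exact Free.zero e, by rw [h.pd, h]; ring⟩

lemma Aff.add {e : E} {p q : MvPolynomial E K} (hp : Aff e p) (hq : Aff e q) : Aff e (p + q) := by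
  refine ⟨by rw [map_add]; exact hp.1.add hq.1, ?_⟩
  nth_rw 1 [hp.2, hq.2]; rw [map_add, map_add]; ring
lemma Aff.sub {e : E} {p q : MvPolynomial E K} (hp : Aff e p) (hq : Aff e q) : Aff e (p - q) := by
  refine ⟨by rw [map_sub]; exact hp.1.sub hq.1, ?_⟩
  nth_rw 1 [hp.2, hq.2]; rw [map_sub, map_sub]; ring
lemma Aff.pderiv {e : E} (f : E) {p : MvPolynomial E K} (hp : Aff e p) : Aff e (pderiv f p) := by
  by_cases hfe : f = e
  · subst hfe; exact hp.1.aff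
  · refine ⟨by rw [pd_comm]; exact hp.1.pderiv f, ?_⟩
    nth_rw 1 [hp.2]
    rw [map_add, pderiv_mul, pderiv_X_of_ne (Ne.symm hfe), pderiv_sg_ne hfe, pd_comm f e]; ring
lemma Aff.sg {e : E} (f : E) {p : MvPolynomial E K} (hp : Aff e p) : Aff e (sg f p) := by
  by_cases hfe : f = e
  · subst hfe; exact (free_sg f p).aff
  · refine ⟨?_, ?_⟩
    · rw [Free, pderiv_sg_ne (Ne.symm hfe), sg_comm, hp.1]
    · nth_rw 1 [hp.2]
      rw [map_add, map_mul, sg_X_ne (Ne.symm hfe), pderiv_sg_ne (Ne.symm hfe), sg_comm]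
lemma MA.sub {p q : MvPolynomial E K} (hp : MA p) (hq : MA q) : MA (p - q) := fun e => (hp e).sub (hq e)
lemma MA.pderiv (f : E) {p : MvPolynomial E K} (hp : MA p) : MA (pderiv f p) := fun e => (hp e).pderiv f

lemma Aff.free_of_pd {e : E} {p : MvPolynomial E K} (hp : Aff e p) (h : MvPolynomial.pderiv e p = 0) : Free e p := by
  have := hp.2
  rw [h, mul_zero, zero_add] at this
  exact this.symm

lemma lin_zero {e : E} {B C : MvPolynomial E K} (hB : Free e B) (hC : Free e C)
    (h : X e * B + C = 0) : B = 0 ∧ C = 0 := by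
  have := aff_of hB hC
  rw [h, map_zero, map_zero] at this
  exact ⟨this.1.symm, this.2.symm⟩

lemma quad_zero {e : E} {A B C : MvPolynomial E K} (hA : Free e A) (hB : Free e B) (hC : Free e C)
    (h : X e * X e * A + X e * B + C = 0) : A = 0 ∧ B = 0 ∧ C = 0 := by
  have hC0 : C = 0 := by
    have := congrArg (Config.sg e) h
    rw [map_add, map_add, map_mul, map_mul, map_mul, hC, sg_X_self, map_zero] at this
    simpa using this
  have h2 : X e * (X e * A + B) = 0 := by rw [← h, hC0]; ring
  have h3 := lin_zero hA hB ((mul_eq_zero.mp h2).resolve_left (X_ne_zero e))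
  exact ⟨h3.1, h3.2, hC0⟩

lemma coeff_sg (e : E) (p : MvPolynomial E K) (m : E →₀ ℕ) :
    coeff m (sg e p) = if m e = 0 then coeff m p else 0 := by
  have key : ∀ (n : E →₀ ℕ) (c : K), sg e (monomial n c) = if n e = 0 then monomial n c else 0 := by
    intro n c
    rw [sg, aeval_monomial]
    split_ifs with h
    · rw [monomial_eq, MvPolynomial.algebraMap_eq]
      congr 1
      refine Finsupp.prod_congr fun g hg => ?_
      rw [if_neg]
      rintro rfl
      exact (Finsupp.mem_support_iff.mp hg) h
    · have : n.prod (fun i k => (if i = e then (0 : MvPolynomial E K) else X i) ^ k) = 0 := by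
        refine Finset.prod_eq_zero (Finsupp.mem_support_iff.mpr h) ?_
        simp [h]
      rw [this, mul_zero]
  induction p using MvPolynomial.induction_on' with
  | monomial n c =>
    rw [key]
    split_ifs with h1 h2 h2
    · rfl
    · rw [coeff_monomial, if_neg]; rintro rfl; exact h2 h1
    · rw [coeff_zero, coeff_monomial, if_neg]; rintro rfl; exact h1 h2
    · rw [coeff_zero]
  | add p q hp hq =>
    rw [map_add, coeff_add, hp, hq]; split_ifs <;> simp

lemma free_iff_coeff {e : E} {p : MvPolynomial E K} : Free e p ↔ ∀ m, coeff m p ≠ 0 → m e = 0 := by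
  constructor
  · intro h m hm
    by_contra h0
    apply hm
    rw [← h, coeff_sg, if_neg h0]
  · intro h
    ext m
    rw [coeff_sg]
    split_ifs with h0
    · rfl
    · by_contra hc
      exact h0 (h m (Ne.symm hc))

lemma free_iff_degreeOf {e : E} {p : MvPolynomial E K} : Free e p ↔ degreeOf e p = 0 := by
  rw [free_iff_coeff, ← Nat.le_zero, degreeOf_le_iff]
  simp [mem_support_iff]

lemma eq_C_of_free {p : MvPolynomial E K} (h : ∀ e, Free e p) : p = C (coeff 0 p) := by
  ext m
  rw [coeff_C]
  split_ifs with h0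
  · rw [← h0]
  · by_contra hc
    exact h0 (Finsupp.ext fun e => (free_iff_coeff.mp (h e) m hc).symm)

lemma exists_pd_ne_zero {p : MvPolynomial E K} (hp : MA p) (h0 : p ≠ 0) {d : ℕ}
    (hd : p.IsHomogeneous d) (hd0 : d ≠ 0) : ∃ f, pderiv f p ≠ 0 := by
  by_contra hcon
  push Not at hcon
  have h1 := eq_C_of_free (fun e => (hp e).free_of_pd (hcon e))
  have h2 : p.IsHomogeneous 0 := by rw [h1]; exact isHomogeneous_C _ _
  exact hd0 (hd.inj_right h2 h0)

lemma MA.degreeOf_le {p : MvPolynomial E K} (hp : MA p) (e : E) : degreeOf e p ≤ 1 := by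
  rw [(hp e).2]
  refine (degreeOf_add_le _ _ _).trans (max_le ?_ ?_)
  · refine (degreeOf_mul_le _ _ _).trans ?_
    rw [free_iff_degreeOf.mp (hp e).1, degreeOf_X, if_pos rfl]
  · rw [free_iff_degreeOf.mp (free_sg e p)]; omega

end Aff
end Config


namespace Config
section DS
open MvPolynomial

variable {K : Type} [Field K] {E : Type} [Fintype E] [DecidableEq E]
  {V : Type} [AddCommGroup V] [Module K V]

/-- abstract system of polynomials behaving like `det Q`, `adj Q` and second order minors -/
structure DSys (K : Type) [Field K] (E : Type) [Fintype E] [DecidableEq E]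
  (V : Type) [AddCommGroup V] [Module K V] where
  w : E → V
  psi : MvPolynomial E K
  N : V → V → MvPolynomial E K
  D : V → V → V → V → MvPolynomial E K
  d : ℕ
  U0 : Submodule K V
  psi_ne : psi ≠ 0
  psi_MA : MA psi
  N_MA : ∀ u v, MA (N u v)
  D_MA : ∀ s t p q, MA (D s t p q)
  N_add : ∀ u u' v, N (u + u') v = N u v + N u' v
  N_smul : ∀ (c : K) u v, N (c • u) v = C c * N u v
  N_symm : ∀ u v, N u v = N v u
  jac : ∀ s t p q, psi * D s t p q = N s p * N t q - N s q * N t p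
  dpsi : ∀ e, pderiv e psi = N (w e) (w e)
  dN : ∀ e u v, pderiv e (N u v) = D (w e) u (w e) v
  N_hom : ∀ u v, (N u v).IsHomogeneous d
  N_U0 : ∀ u ∈ U0, ∀ v, N u v = 0
  adj : ∀ φ : V →ₗ[K] K, (∀ u ∈ U0, φ u = 0) → ∀ u,
    ∑ g, X g * C (φ (w g)) * N u (w g) = psi * C (φ u)

namespace DSys
variable (S : DSys K E V)

lemma key (e : E) (u v : V) : S.psi * pderiv e (S.N u v) =
    S.N (S.w e) (S.w e) * S.N u v - S.N (S.w e) v * S.N u (S.w e) := by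
  rw [S.dN, S.jac]

lemma pd_self (e : E) (v : V) : pderiv e (S.N (S.w e) v) = 0 := by
  have := S.key e (S.w e) v
  rw [mul_comm (S.N (S.w e) v), sub_self] at this
  exact (mul_eq_zero.mp this).resolve_left S.psi_ne

lemma pd_self' (e : E) (v : V) : pderiv e (S.N v (S.w e)) = 0 := by
  rw [S.N_symm]; exact S.pd_self e v

lemma free_N (e : E) (v : V) : Free e (S.N v (S.w e)) :=
  (S.N_MA _ _ e).free_of_pd (S.pd_self' e v)

lemma N_loop (e f : E) (h : S.N (S.w f) (S.w f) = 0) : S.N (S.w f) (S.w e) = 0 := by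
  have := S.key e (S.w f) (S.w f)
  rw [h, map_zero, mul_zero, mul_zero, zero_sub, S.N_symm (S.w e), zero_eq_neg] at this
  exact mul_self_eq_zero.mp this

lemma nonloop_of_pd {e f : E} (h : pderiv f (S.N (S.w e) (S.w e)) ≠ 0) : S.N (S.w f) (S.w f) ≠ 0 := by
  intro h0
  have := S.key f (S.w e) (S.w e)
  rw [h0, S.N_loop e f h0] at this
  rw [zero_mul, zero_mul, sub_zero] at this
  exact h ((mul_eq_zero.mp this).resolve_left S.psi_ne)

/-- contraction -/
noncomputable def contr (c : E) (hc : S.N (S.w c) (S.w c) ≠ 0) : DSys K E V where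
  w := S.w
  psi := pderiv c S.psi
  N := fun u v => pderiv c (S.N u v)
  D := fun s t p q => pderiv c (S.D s t p q)
  d := S.d - 1
  U0 := S.U0 ⊔ Submodule.span K {S.w c}
  psi_ne := by rw [S.dpsi]; exact hc
  psi_MA := S.psi_MA.pderiv c
  N_MA := fun u v => (S.N_MA u v).pderiv c
  D_MA := fun s t p q => (S.D_MA s t p q).pderiv c
  N_add := fun u u' v => by rw [S.N_add, map_add]
  N_smul := fun a u v => by rw [S.N_smul, pderiv_C_mul]
  N_symm := fun u v => by rw [S.N_symm]
  jac := fun s t p q => by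
    have h := S.jac s t p q
    have h1 := (S.psi_MA c)
    have h2 := (S.D_MA s t p q c)
    have h3 := (S.N_MA s p c)
    have h4 := (S.N_MA t q c)
    have h5 := (S.N_MA s q c)
    have h6 := (S.N_MA t p c)
    rw [h1.2, h2.2, h3.2, h4.2, h5.2, h6.2] at h
    have hz := quad_zero (e := c)
      (A := pderiv c S.psi * pderiv c (S.D s t p q) - (pderiv c (S.N s p) * pderiv c (S.N t q)
        - pderiv c (S.N s q) * pderiv c (S.N t p)))
      (B := pderiv c S.psi * sg c (S.D s t p q) + sg c S.psi * pderiv c (S.D s t p q)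
        - ((pderiv c (S.N s p) * sg c (S.N t q) + sg c (S.N s p) * pderiv c (S.N t q))
        - (pderiv c (S.N s q) * sg c (S.N t p) + sg c (S.N s q) * pderiv c (S.N t p))))
      (C := sg c S.psi * sg c (S.D s t p q) - (sg c (S.N s p) * sg c (S.N t q)
        - sg c (S.N s q) * sg c (S.N t p)))
      ((h1.1.mul h2.1).sub ((h3.1.mul h4.1).sub (h5.1.mul h6.1)))
      (((h1.1.mul (free_sg c _)).add ((free_sg c _).mul h2.1)).sub
        (((h3.1.mul (free_sg c _)).add ((free_sg c _).mul h4.1)).sub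
        ((h5.1.mul (free_sg c _)).add ((free_sg c _).mul h6.1))))
      (((free_sg c _).mul (free_sg c _)).sub
        (((free_sg c _).mul (free_sg c _)).sub ((free_sg c _).mul (free_sg c _))))
      (by linear_combination h)
    exact sub_eq_zero.mp hz.1
  dpsi := fun e => by rw [pd_comm, S.dpsi]
  dN := fun e u v => by rw [pd_comm, S.dN]
  N_hom := fun u v => (S.N_hom u v).pderiv
  N_U0 := fun u hu v => by
    obtain ⟨u0, hu0, x, hx, rfl⟩ := Submodule.mem_sup.mp hu
    obtain ⟨k, rfl⟩ := Submodule.mem_span_singleton.mp hx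
    rw [S.N_add, S.N_smul, S.N_U0 u0 hu0, zero_add, pderiv_C_mul, S.pd_self, mul_zero]
  adj := fun φ hφ u => by
    have h := congrArg (pderiv c) (S.adj φ (fun u hu => hφ u (Submodule.mem_sup_left hu)) u)
    have hc0 : φ (S.w c) = 0 := hφ _ (Submodule.mem_sup_right (Submodule.mem_span_singleton_self _))
    rw [map_sum, pderiv_mul, pderiv_C, mul_zero, add_zero] at h
    rw [← h]
    refine Finset.sum_congr rfl fun g _ => ?_
    rw [pderiv_mul, pderiv_mul, pderiv_C, mul_zero, add_zero]
    by_cases hg : g = c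
    · subst hg; rw [hc0]; simp
    · rw [pderiv_X_of_ne hg]; ring

/-- differentiated adjugate identity -/
lemma adj_pd (φ : V →ₗ[K] K) (hφ : ∀ u ∈ S.U0, φ u = 0) (u : V) (f : E) :
    ∑ g, X g * C (φ (S.w g)) * pderiv f (S.N u (S.w g)) + C (φ (S.w f)) * S.N u (S.w f) =
      S.N (S.w f) (S.w f) * C (φ u) := by
  have h := congrArg (pderiv f) (S.adj φ hφ u)
  rw [map_sum, pderiv_mul, pderiv_C, mul_zero, add_zero, S.dpsi] at h
  rw [← h]
  have : C (φ (S.w f)) * S.N u (S.w f) = ∑ g, if g = f then C (φ (S.w g)) * S.N u (S.w g) else 0 := by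
    simp
  rw [this, ← Finset.sum_add_distrib]
  refine Finset.sum_congr rfl fun g _ => ?_
  rw [pderiv_mul, pderiv_mul, pderiv_C, mul_zero, add_zero]
  split_ifs with hg
  · subst hg; rw [pderiv_X_self]; ring
  · rw [pderiv_X_of_ne hg]; ring

/-- connectedness -/
def Conn : Prop := ∀ s t : E, S.N (S.w s) (S.w s) ≠ 0 → S.N (S.w t) (S.w t) ≠ 0 → S.N (S.w s) (S.w t) ≠ 0

/-- abbreviation for elements indexed by the ground set -/
def n (s t : E) : MvPolynomial E K := S.N (S.w s) (S.w t)

lemma n_symm (s t : E) : S.n s t = S.n t s := S.N_symm _ _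

lemma keyn (e s t : E) : S.psi * pderiv e (S.n s t) = S.n e e * S.n s t - S.n e t * S.n s e :=
  S.key e _ _

lemma conn_contr_of (f : E) (hf : S.N (S.w f) (S.w f) ≠ 0) (e : E)
    (he : pderiv f (S.n e e) ≠ 0)
    (h : ∀ g, pderiv f (S.n g g) ≠ 0 → pderiv f (S.n e g) ≠ 0) : (S.contr f hf).Conn := by
  intro s t hs ht hst
  -- transitivity
  set T := S.contr f hf with hT
  have h1 := T.keyn e s t
  have h2 : T.n s t = 0 := hst
  rw [h2, map_zero, mul_zero, mul_zero, zero_sub, zero_eq_neg] at h1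
  rcases mul_eq_zero.mp h1 with h3 | h3
  · exact h t ht h3
  · rw [T.n_symm] at h3; exact h s hs h3

lemma chain (hS : S.Conn) (e : E) (he : S.n e e ≠ 0) (hex : ∃ f, pderiv f (S.n e e) ≠ 0) :
    ∃ f, ∃ hf : S.N (S.w f) (S.w f) ≠ 0, pderiv f (S.n e e) ≠ 0 ∧ (S.contr f hf).Conn := by
  classical
  let Xs : E → Finset E := fun f => Finset.univ.filter fun s => pderiv f (S.n e s) ≠ 0
  obtain ⟨f0, hf0⟩ := hex
  obtain ⟨f, hfm, hmax⟩ := Finset.exists_max_image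
    (Finset.univ.filter fun f => pderiv f (S.n e e) ≠ 0) (fun f => (Xs f).card)
    ⟨f0, by simpa using hf0⟩
  have hfe : pderiv f (S.n e e) ≠ 0 := by simpa using hfm
  have hff : S.N (S.w f) (S.w f) ≠ 0 := S.nonloop_of_pd hfe
  refine ⟨f, hff, hfe, S.conn_contr_of f hff e hfe ?_⟩
  intro g hg hcon
  have hgg : S.n g g ≠ 0 := fun h => hg (by rw [h, map_zero])
  -- elements of `Xs f` lie in `Xs g`
  have hsub : ∀ s, pderiv f (S.n e s) ≠ 0 → pderiv g (S.n e s) ≠ 0 := by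
    intro s hs h0
    have h1 : (S.contr f hff).psi * pderiv g ((S.contr f hff).n e s) = _ := (S.contr f hff).keyn g e s
    have h2 : (S.contr f hff).n e g = 0 := hcon
    have h3 : pderiv g ((S.contr f hff).n e s) = 0 := by
      show pderiv g (pderiv f (S.n e s)) = 0
      rw [pd_comm, h0, map_zero]
    rw [h2, h3, mul_zero, mul_zero, sub_zero] at h1
    rcases mul_eq_zero.mp h1.symm with h4 | h4
    · exact hg h4
    · exact hs h4
  have hf_in : pderiv g (S.n e f) ≠ 0 := by
    intro h0
    have h1 := S.keyn g e f
    have h2 := S.keyn f e g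
    rw [h0, mul_zero] at h1
    rw [hcon, mul_zero] at h2
    have hef : S.n e f ≠ 0 := hS e f he hff
    have heg : S.n e g ≠ 0 := hS e g he hgg
    have h3 := S.keyn f g g
    have h4 : S.n e f * S.n e g * (S.n f f * S.n g g - S.n f g * S.n g f) = 0 := by
      rw [S.n_symm g f] at *
      linear_combination (-S.n f f * S.n e g) * h1 - S.n e g * S.n f g * h2
    rw [← h3] at h4
    exact (mul_ne_zero (mul_ne_zero hef heg) (mul_ne_zero S.psi_ne hg)) h4
  have hlt : (Xs f).card < (Xs g).card := by
    apply Finset.card_lt_card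
    refine Finset.ssubset_iff.mpr ⟨f, ?_, ?_⟩
    · simp only [Xs, Finset.mem_filter, Finset.mem_univ, true_and, not_not]
      exact S.pd_self' f _
    · intro s hs
      rcases Finset.mem_insert.mp hs with rfl | hs
      · simpa [Xs] using hf_in
      · simp only [Xs, Finset.mem_filter, Finset.mem_univ, true_and] at hs ⊢
        exact hsub s hs
  have := hmax g (by simpa using hsub e hfe)
  omega

lemma exists_pd (e : E) (he : S.n e e ≠ 0) (hd : S.d ≠ 0) : ∃ f, pderiv f (S.n e e) ≠ 0 :=
  exists_pd_ne_zero (S.N_MA _ _) he (S.N_hom _ _) hd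

/-- the ideal of the `e`-th column -/
noncomputable def Jid (e : E) : Ideal (MvPolynomial E K) := Ideal.span (Set.range fun u => S.N u (S.w e))

/-- the ideal of all entries -/
noncomputable def Iid : Ideal (MvPolynomial E K) :=
  Ideal.span (Set.range fun x : V × V => S.N x.1 x.2)

lemma J_le_I (e : E) : S.Jid e ≤ S.Iid := by
  rw [Jid, Ideal.span_le]
  rintro _ ⟨u, rfl⟩
  exact Ideal.subset_span ⟨(u, S.w e), rfl⟩

lemma isUnit_of_d {e : E} (he : S.n e e ≠ 0) (hd : S.d = 0) : IsUnit (S.n e e) := by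
  have h := S.N_hom (S.w e) (S.w e)
  rw [hd] at h
  have h1 : S.n e e = C (coeff 0 (S.n e e)) := by
    rw [← totalDegree_eq_zero_iff_eq_C]
    exact h.totalDegree he
  rw [h1] at he ⊢
  exact (IsUnit.mk0 _ (fun h0 => he (by rw [h0, map_zero]))).map C

end DSys
end DS
end Config


namespace Config
section HT
open MvPolynomial

variable {K : Type} [Field K] {E : Type} [Fintype E] [DecidableEq E]
  {V : Type} [AddCommGroup V] [Module K V]

/-- adjoin a generic value for `x_e` -/
noncomputable def rho (e : E) : MvPolynomial E K →ₐ[K] Polynomial (MvPolynomial E K) :=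
  aeval fun g => if g = e then Polynomial.X else Polynomial.C (X g)

lemma rho_sg (e : E) (p : MvPolynomial E K) : rho e (sg e p) = Polynomial.C (sg e p) := by
  induction p using MvPolynomial.induction_on with
  | C a =>
    rw [sg_C, rho, aeval_C]
    rfl
  | add p q hp hq => rw [map_add, map_add, hp, hq, map_add]
  | mul_X p f hp =>
    rw [map_mul, map_mul, hp]
    by_cases hf : f = e
    · subst hf; simp
    · rw [sg_X_ne hf]; simp [rho, hf]

lemma rho_free {e : E} {p : MvPolynomial E K} (h : Free e p) : rho e p = Polynomial.C p := by
  have := rho_sg e p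
  rwa [h] at this

lemma eval_rho (e : E) (p : MvPolynomial E K) : Polynomial.eval (X e) (rho e p) = p := by
  induction p using MvPolynomial.induction_on with
  | C a =>
    rw [rho_free (Free.C e a), Polynomial.eval_C]
  | add p q hp hq => rw [map_add, Polynomial.eval_add, hp, hq]
  | mul_X p f hp =>
    rw [map_mul, Polynomial.eval_mul, hp]
    congr 1
    by_cases hf : f = e
    · subst hf; simp [rho]
    · simp [rho, hf]

/-- largest prime inside `P` generated by elements free of `x_e` -/
noncomputable def qe (e : E) (P : Ideal (MvPolynomial E K)) : Ideal (MvPolynomial E K) :=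
  (P.map Polynomial.C).comap (rho e)

lemma qe_prime (e : E) (P : Ideal (MvPolynomial E K)) [P.IsPrime] : (qe e P).IsPrime := by
  have : (P.map (Polynomial.C : MvPolynomial E K →+* _)).IsPrime := Ideal.isPrime_map_C_of_isPrime
  exact Ideal.IsPrime.comap _

lemma qe_le (e : E) (P : Ideal (MvPolynomial E K)) : qe e P ≤ P := by
  intro x hx
  have hx' : rho e x ∈ P.map Polynomial.C := hx
  rw [Ideal.mem_map_C_iff] at hx'
  rw [← eval_rho e x, Polynomial.eval_eq_sum, Polynomial.sum]
  exact Ideal.sum_mem _ fun n _ => P.mul_mem_right _ (hx' n)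

lemma mem_qe_free {e : E} {P : Ideal (MvPolynomial E K)} {x : MvPolynomial E K} (h : Free e x)
    (hx : x ∈ P) : x ∈ qe e P := by
  show rho e x ∈ P.map Polynomial.C
  rw [rho_free h]
  exact Ideal.mem_map_of_mem _ hx

lemma pd_mem_of_mem_qe {e : E} {P : Ideal (MvPolynomial E K)} {p : MvPolynomial E K} (h : Aff e p)
    (hx : p ∈ qe e P) : pderiv e p ∈ P := by
  have hx' : rho e p ∈ P.map Polynomial.C := hx
  rw [Ideal.mem_map_C_iff] at hx'
  have h1 := hx' 1
  rw [h.2, map_add, map_mul, rho_free h.1, rho_free (free_sg e p)] at h1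
  simpa [rho, Polynomial.coeff_C] using h1

lemma ht_lemma {k : ℕ} {P : Ideal (MvPolynomial E K)} [hP : P.IsPrime] : ∀ (d : ℕ) (p : MvPolynomial E K),
    p ∈ P → p ≠ 0 → MA p → p.IsHomogeneous d →
    (∀ e, pderiv e p ≠ 0 → ∃ b : Set (MvPolynomial E K), b ⊆ P ∧ (∀ x ∈ b, Free e x) ∧
      HtGE (Ideal.span b) k) → ((k + 1 : ℕ) : ℕ∞) ≤ P.height := by
  intro d
  induction d with
  | zero =>
    intro p hp h0 _ hh _
    exfalso
    have h1 : p = C (coeff 0 p) := by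
      rw [← totalDegree_eq_zero_iff_eq_C]
      exact hh.totalDegree h0
    apply hP.ne_top
    rw [Ideal.eq_top_iff_one]
    have hc : coeff 0 p ≠ 0 := fun h => h0 (by rw [h1, h, map_zero])
    have : (1 : MvPolynomial E K) = C ((coeff 0 p)⁻¹) * p := by
      nth_rw 2 [h1]
      rw [← map_mul, inv_mul_cancel₀ hc, map_one]
    rw [this]
    exact P.mul_mem_left _ hp
  | succ d ih =>
    intro p hp h0 hM hh H
    obtain ⟨e, he⟩ := exists_pd_ne_zero hM h0 hh (Nat.succ_ne_zero d)
    by_cases hq : qe e P = P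
    · refine ih (pderiv e p) (pd_mem_of_mem_qe (hM e) (by rw [hq]; exact hp)) he (hM.pderiv e) ?_ ?_
      · simpa using hh.pderiv (i := e)
      · intro f hf
        refine H f fun h => hf ?_
        rw [pd_comm, h, map_zero]
    · have hlt : qe e P < P := lt_of_le_of_ne (qe_le e P) hq
      obtain ⟨b, hb, hbf, hbh⟩ := H e he
      have hpr := qe_prime e P
      have h1 : (k : ℕ∞) ≤ (qe e P).height := hbh _ hpr (Ideal.span_le.mpr fun x hx =>
        mem_qe_free (hbf x hx) (hb hx))
      have h2 : (qe e P).height + 1 ≤ P.height := Ideal.height_add_one_le_of_lt_of_isPrime hlt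
      push_cast
      exact (add_le_add_left h1 1).trans h2

lemma htge_one {x : MvPolynomial E K} (hx : x ≠ 0) : HtGE (Ideal.span {x}) 1 := by
  intro P hP hxP
  have hb : (⊥ : Ideal (MvPolynomial E K)) < P := by
    rw [bot_lt_iff_ne_bot]
    rintro rfl
    exact hx (by simpa using hxP (Ideal.mem_span_singleton_self x))
  have := Ideal.height_add_one_le_of_lt_of_isPrime hb
  exact le_trans (by simp) this

namespace DSys
variable (S : DSys K E V)

lemma N_mem_J (u : V) (e : E) : S.N u (S.w e) ∈ S.Jid e := Ideal.subset_span ⟨u, rfl⟩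
lemma N_mem_I (u v : V) : S.N u v ∈ S.Iid := Ideal.subset_span ⟨(u, v), rfl⟩

lemma h1 (hS : S.Conn) (e : E) (he : S.n e e ≠ 0) : HtGE (S.Jid e) 2 := by
  intro P hP hJ
  refine ht_lemma (k := 1) S.d (S.n e e) (hJ (S.N_mem_J _ e)) he (S.N_MA _ _) (S.N_hom _ _) ?_
  intro f hf
  refine ⟨{S.n e f}, ?_, ?_, htge_one (hS e f he (S.nonloop_of_pd hf))⟩
  · rw [Set.singleton_subset_iff, S.n_symm]
    exact hJ (S.N_mem_J _ e)
  · rintro x rfl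
    exact S.free_N f _

lemma h2 (hS : S.Conn) (e : E) (he : S.n e e ≠ 0) : HtGE S.Iid 3 := by
  intro P hP hI
  refine ht_lemma (k := 2) S.d (S.n e e) (hI (S.N_mem_I _ _)) he (S.N_MA _ _) (S.N_hom _ _) ?_
  intro f hf
  refine ⟨Set.range fun u => S.N u (S.w f), ?_, ?_, S.h1 hS f (S.nonloop_of_pd hf)⟩
  · rintro _ ⟨u, rfl⟩
    exact hI (S.N_mem_I _ _)
  · rintro _ ⟨u, rfl⟩
    exact S.free_N f _

end DSys
end HT
end Config


namespace Config
section GT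
open MvPolynomial

variable {K : Type} [Field K] {E : Type} [Fintype E] [DecidableEq E]
  {V : Type} [AddCommGroup V] [Module K V]

lemma exists_functional (U : Submodule K V) (v : V) (hv : v ∉ U) :
    ∃ φ : V →ₗ[K] K, (∀ u ∈ U, φ u = 0) ∧ φ v = 1 := by
  obtain ⟨φ, h1, h2⟩ := Submodule.exists_le_ker_of_notMem hv
  refine ⟨(φ v)⁻¹ • φ, fun u hu => ?_, ?_⟩
  · rw [LinearMap.smul_apply, LinearMap.mem_ker.mp (h2 hu), smul_zero]
  · rw [LinearMap.smul_apply, smul_eq_mul, inv_mul_cancel₀ h1]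

namespace DSys
variable (S : DSys K E V)

lemma exists_fun_f {e f : E} (hf : S.n f f ≠ 0) (hfe : pderiv f (S.n e e) ≠ 0) :
    ∃ φ : V →ₗ[K] K, (∀ u ∈ S.U0, φ u = 0) ∧ φ (S.w e) = 0 ∧ φ (S.w f) = 1 := by
  have h : S.w f ∉ S.U0 ⊔ Submodule.span K {S.w e} := by
    intro hmem
    obtain ⟨u0, hu0, x, hx, hsum⟩ := Submodule.mem_sup.mp hmem
    obtain ⟨k, rfl⟩ := Submodule.mem_span_singleton.mp hx
    have h1 : ∀ v, S.N (S.w f) v = C k * S.N (S.w e) v := fun v => by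
      rw [← hsum, S.N_add, S.N_U0 u0 hu0, zero_add, S.N_smul]
    have hk : k ≠ 0 := by
      rintro rfl
      apply hf
      rw [n, h1]; simp
    have h2 := congrArg (pderiv f) (h1 (S.w e))
    rw [S.pd_self, pderiv_C_mul] at h2
    rcases mul_eq_zero.mp h2.symm with h3 | h3
    · exact hk (by simpa using h3)
    · exact hfe h3
  obtain ⟨φ, h1, h2⟩ := exists_functional _ _ h
  exact ⟨φ, fun u hu => h1 u (Submodule.mem_sup_left hu),
    h1 _ (Submodule.mem_sup_right (Submodule.mem_span_singleton_self _)), h2⟩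

lemma exists_fun_e {e f : E} (hfe : pderiv f (S.n e e) ≠ 0) :
    ∃ φ : V →ₗ[K] K, (∀ u ∈ S.U0, φ u = 0) ∧ φ (S.w f) = 0 ∧ φ (S.w e) = 1 := by
  have h : S.w e ∉ S.U0 ⊔ Submodule.span K {S.w f} := by
    intro hmem
    obtain ⟨u0, hu0, x, hx, hsum⟩ := Submodule.mem_sup.mp hmem
    obtain ⟨k, rfl⟩ := Submodule.mem_span_singleton.mp hx
    have h1 : ∀ v, S.N (S.w e) v = C k * S.N (S.w f) v := fun v => by
      rw [← hsum, S.N_add, S.N_U0 u0 hu0, zero_add, S.N_smul]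
    apply hfe
    rw [n, h1, pderiv_C_mul, S.pd_self, mul_zero]
  obtain ⟨φ, h1, h2⟩ := exists_functional _ _ h
  exact ⟨φ, fun u hu => h1 u (Submodule.mem_sup_left hu),
    h1 _ (Submodule.mem_sup_right (Submodule.mem_span_singleton_self _)), h2⟩

lemma nef_mem_contr {e f : E} (hf : S.N (S.w f) (S.w f) ≠ 0) (hfe : pderiv f (S.n e e) ≠ 0) :
    S.n e f ∈ (S.contr f hf).Jid e := by
  obtain ⟨φ, h1, h2, h3⟩ := S.exists_fun_f hf hfe
  have h := S.adj_pd φ h1 (S.w e) f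
  rw [h2, h3, map_zero, mul_zero, map_one, one_mul] at h
  have h4 : S.n e f = - ∑ g, X g * C (φ (S.w g)) * pderiv f (S.N (S.w e) (S.w g)) := by
    rw [n]; linear_combination h
  rw [h4]
  refine neg_mem (Ideal.sum_mem _ fun g _ => Ideal.mul_mem_left _ _ ?_)
  rw [S.N_symm]
  exact (S.contr f hf).N_mem_J (S.w g) e

lemma J_le_contr {e f : E} (hf : S.N (S.w f) (S.w f) ≠ 0) (hfe : pderiv f (S.n e e) ≠ 0) :
    S.Jid f ≤ (S.contr f hf).Iid := by
  have hs : ∀ (φ : V →ₗ[K] K) u, ∑ g, X g * C (φ (S.w g)) * pderiv f (S.N u (S.w g)) ∈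
      (S.contr f hf).Iid := fun φ u =>
    Ideal.sum_mem _ fun g _ => Ideal.mul_mem_left _ _ ((S.contr f hf).N_mem_I u (S.w g))
  have hff : S.n f f ∈ (S.contr f hf).Iid := by
    obtain ⟨φ, h1, h2, h3⟩ := S.exists_fun_e hfe
    have h := S.adj_pd φ h1 (S.w e) f
    rw [h2, h3, map_zero, zero_mul, map_one, mul_one, add_zero] at h
    rw [n, ← h]
    exact hs φ _
  obtain ⟨φ, h1, -, h3⟩ := S.exists_fun_f hf hfe
  rw [Jid, Ideal.span_le]
  rintro _ ⟨u, rfl⟩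
  have h := S.adj_pd φ h1 u f
  rw [h3, map_one, one_mul] at h
  have h4 : S.N u (S.w f) = S.n f f * C (φ u) -
      ∑ g, X g * C (φ (S.w g)) * pderiv f (S.N u (S.w g)) := by
    rw [n]; linear_combination h
  show S.N u (S.w f) ∈ _
  rw [h4]
  exact sub_mem (Ideal.mul_mem_right _ _ hff) (hs φ u)

lemma hab2 (e f : E) (u u' : V) : pderiv f (S.N u (S.w e)) * S.N u' (S.w e) -
    pderiv f (S.N u' (S.w e)) * S.N u (S.w e) = S.n e f * S.D u' u (S.w f) (S.w e) := by
  apply mul_left_cancel₀ S.psi_ne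
  have h1 := S.key f u (S.w e)
  have h2 := S.key f u' (S.w e)
  have h3 := S.jac u' u (S.w f) (S.w e)
  rw [S.n_symm, n]
  linear_combination (S.N u' (S.w e)) * h1 - (S.N u (S.w e)) * h2 - S.N (S.w f) (S.w e) * h3

lemma hab3 (f : E) (u v u' v' : V) : pderiv f (S.N u v) * S.N u' v' -
    pderiv f (S.N u' v') * S.N u v = S.N u' (S.w f) * S.D (S.w f) u v' v +
      S.N v (S.w f) * S.D u' u (S.w f) v' := by
  apply mul_left_cancel₀ S.psi_ne
  have h1 := S.key f u v
  have h2 := S.key f u' v'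
  have h3 := S.jac u' u (S.w f) v'
  have h4 := S.jac (S.w f) u v' v
  rw [S.N_symm v (S.w f)]
  linear_combination (S.N u' v') * h1 - (S.N u v) * h2 - S.N (S.w f) v * h3 - S.N u' (S.w f) * h4

theorem G2 : ∀ (d : ℕ) (S : DSys K E V), S.d = d → S.Conn → ∀ e, S.n e e ≠ 0 → GG 2 (S.Jid e) := by
  intro d
  induction d with
  | zero =>
    intro S hd hS e he
    exact GG_top _ _ (Ideal.eq_top_of_isUnit_mem _ (S.N_mem_J _ e) (S.isUnit_of_d he hd))
  | succ d ih =>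
    intro S hd hS e he
    obtain ⟨f, hf, hfe, hS'⟩ := S.chain hS e he (S.exists_pd e he (by omega))
    have hef : S.n e f ≠ 0 := hS e f he hf
    set S' := S.contr f hf with hS'def
    have he' : S'.n e e ≠ 0 := hfe
    have hGJ : GG 1 (Ideal.span {S.n e f}) := GG_principal (CMprop.mvPolynomial K E) _ hef
    have hG := ih S' (by show S.d - 1 = d; omega) hS' e he'
    have e1 : S'.Jid e = Ideal.span {S.n e f} ⊔
        Ideal.span (Set.range fun u => pderiv f (S.N u (S.w e))) := by
      apply le_antisymm
      · exact le_sup_right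
      · refine sup_le ?_ le_rfl
        rw [Ideal.span_le, Set.singleton_subset_iff]
        exact S.nef_mem_contr hf hfe
    have e2 : S.Jid e = Ideal.span {S.n e f} ⊔ Ideal.span (Set.range fun u => S.N u (S.w e)) := by
      apply le_antisymm
      · exact le_sup_right
      · refine sup_le ?_ le_rfl
        rw [Ideal.span_le, Set.singleton_subset_iff, S.n_symm]
        exact S.N_mem_J _ e
    rw [e1] at hG
    rw [e2]
    refine GG.transfer _ _ _ ?_ ?_ ?_ hGJ hG
    · intro u u'
      show pderiv f (S.N u (S.w e)) * S.N u' (S.w e) -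
        pderiv f (S.N u' (S.w e)) * S.N u (S.w e) ∈ _
      rw [S.hab2]
      exact Ideal.mul_mem_right _ _ (Ideal.mem_span_singleton_self _)
    · intro c hc
      refine hGJ.colon_span (S'.h1 hS' e he') c ?_
      rintro _ ⟨u, rfl⟩
      exact hc u
    · intro c hc
      refine hGJ.colon_span (S.h1 hS e he) c ?_
      rintro _ ⟨u, rfl⟩
      exact hc u

theorem G3 : ∀ (d : ℕ) (S : DSys K E V), S.d = d → S.Conn → ∀ e, S.n e e ≠ 0 → GG 3 S.Iid := by
  intro d
  induction d with
  | zero =>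
    intro S hd hS e he
    exact GG_top _ _ (Ideal.eq_top_of_isUnit_mem _ (S.N_mem_I _ _) (S.isUnit_of_d he hd))
  | succ d ih =>
    intro S hd hS e he
    obtain ⟨f, hf, hfe, hS'⟩ := S.chain hS e he (S.exists_pd e he (by omega))
    set S' := S.contr f hf with hS'def
    have he' : S'.n e e ≠ 0 := hfe
    have hGJ : GG 2 (S.Jid f) := G2 _ S rfl hS f hf
    have hG := ih S' (by show S.d - 1 = d; omega) hS' e he'
    have e1 : S'.Iid = S.Jid f ⊔
        Ideal.span (Set.range fun x : V × V => pderiv f (S.N x.1 x.2)) := by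
      apply le_antisymm
      · exact le_sup_right
      · exact sup_le (S.J_le_contr hf hfe) le_rfl
    have e2 : S.Iid = S.Jid f ⊔ Ideal.span (Set.range fun x : V × V => S.N x.1 x.2) := by
      apply le_antisymm
      · exact le_sup_right
      · exact sup_le (S.J_le_I f) le_rfl
    rw [e1] at hG
    rw [e2]
    refine GG.transfer _ _ _ ?_ ?_ ?_ hGJ hG
    · intro u u'
      show pderiv f (S.N u.1 u.2) * S.N u'.1 u'.2 -
        pderiv f (S.N u'.1 u'.2) * S.N u.1 u.2 ∈ _
      rw [S.hab3]
      exact add_mem (Ideal.mul_mem_right _ _ (S.N_mem_J _ _)) (Ideal.mul_mem_right _ _ (S.N_mem_J _ _))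
    · intro c hc
      refine hGJ.colon_span (S'.h2 hS' e he') c ?_
      rintro _ ⟨u, rfl⟩
      exact hc u
    · intro c hc
      refine hGJ.colon_span (S.h2 hS e he) c ?_
      rintro _ ⟨u, rfl⟩
      exact hc u

end DSys
end GT
end Config


namespace Config
section PT
open MvPolynomial

variable {K : Type} [Field K] {E : Type} [Fintype E] [DecidableEq E]
  {V : Type} [AddCommGroup V] [Module K V]

lemma GG.colon_pow {R : Type} [CommRing R] {k : ℕ} {I : Ideal R} (hG : GG k I) {s : Set R}
    (hs : HtGE (Ideal.span s) (k + 1)) (p : R) (hp : ∀ x ∈ s, ∃ N : ℕ, x ^ N * p ∈ I) : p ∈ I := by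
  refine hG.colon (b := Submodule.comap (LinearMap.mulRight R p) I) ?_ p ?_
  · intro P hP hb
    refine hs P hP (Ideal.span_le.mpr fun x hx => ?_)
    obtain ⟨N, hN⟩ := hp x hx
    have : x ^ N ∈ P := hb hN
    exact hP.mem_of_pow_mem _ this
  · intro x hx
    exact hx

lemma red_free {e : E} {a h : MvPolynomial E K} (ha : Free e a) (hh : Free e h) (p : MvPolynomial E K) :
    ∃ (N : ℕ) (u : MvPolynomial E K), Free e u ∧ a ^ N * p - u ∈ Ideal.span {a * X e + h} := by
  have hpow : ∀ N : ℕ, Free e (a ^ N) := fun N => by rw [Free, map_pow, ha]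
  induction p using MvPolynomial.induction_on with
  | C c => exact ⟨0, C c, Free.C e c, by simp⟩
  | add p q hp hq =>
    obtain ⟨N, u, hu, h1⟩ := hp
    obtain ⟨M, v, hv, h2⟩ := hq
    refine ⟨N + M, a ^ M * u + a ^ N * v, ((hpow M).mul hu).add ((hpow N).mul hv), ?_⟩
    have : a ^ (N + M) * (p + q) - (a ^ M * u + a ^ N * v) =
      a ^ M * (a ^ N * p - u) + a ^ N * (a ^ M * q - v) := by ring
    rw [this]
    exact add_mem (Ideal.mul_mem_left _ _ h1) (Ideal.mul_mem_left _ _ h2)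
  | mul_X p f hp =>
    obtain ⟨N, u, hu, h1⟩ := hp
    by_cases hf : f = e
    · subst hf
      refine ⟨N + 1, 0 - h * u, (Free.zero f).sub (hh.mul hu), ?_⟩
      have : a ^ (N + 1) * (p * X f) - (0 - h * u) =
        a * X f * (a ^ N * p - u) + u * (a * X f + h) := by ring
      rw [this]
      exact add_mem (Ideal.mul_mem_left _ _ h1) (Ideal.mul_mem_left _ _ (Ideal.mem_span_singleton_self _))
    · refine ⟨N, u * X f, hu.mul (Free.X hf), ?_⟩
      have : a ^ N * (p * X f) - u * X f = X f * (a ^ N * p - u) := by ring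
      rw [this]
      exact Ideal.mul_mem_left _ _ h1

theorem primeP (e : E) (J : Ideal (MvPolynomial E K)) [J.IsPrime] (s : Set (MvPolynomial E K))
    (hs : J = Ideal.span s) (hsf : ∀ x ∈ s, Free e x) {ι : Type} (a h : ι → MvPolynomial E K)
    (ha : ∀ i, Free e (a i)) (hh : ∀ i, Free e (h i)) (i0 : ι) (ha0 : a i0 ∉ J)
    (hrel : ∀ i j, a i * h j - a j * h i ∈ J) (I : Ideal (MvPolynomial E K))
    (hI : I = J ⊔ Ideal.span (Set.range fun i => a i * X e + h i)) (k : ℕ) (hG : GG k I)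
    (hht : HtGE (Ideal.span (Set.range a ∪ Set.range h)) (k + 1)) : I.IsPrime := by
  let L := FractionRing (MvPolynomial E K ⧸ J)
  let io : MvPolynomial E K →+* L := (algebraMap (MvPolynomial E K ⧸ J) L).comp (Ideal.Quotient.mk J)
  have hio : ∀ x, io x = 0 ↔ x ∈ J := by
    intro x
    show algebraMap (MvPolynomial E K ⧸ J) L (Ideal.Quotient.mk J x) = 0 ↔ _
    rw [FaithfulSMul.algebraMap_eq_zero_iff, Ideal.Quotient.eq_zero_iff_mem]
  let tau : MvPolynomial E K →+* L := eval₂Hom (io.comp C)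
    (fun g => if g = e then - io (h i0) / io (a i0) else io (X g))
  have hfree : ∀ p, Free e p → tau p = io p := by
    have : ∀ p, tau (sg e p) = io (sg e p) := by
      intro p
      induction p using MvPolynomial.induction_on with
      | C c => rw [sg_C]; simp [tau]
      | add p q hp hq => rw [map_add, map_add, hp, hq, map_add]
      | mul_X p f hp =>
        rw [map_mul, map_mul, hp, map_mul]
        by_cases hf : f = e
        · subst hf; simp
        · rw [sg_X_ne hf]; simp [tau, hf]
    intro p hp
    have h1 := this p
    rwa [hp] at h1
  have htX : tau (X e) = - io (h i0) / io (a i0) := by simp [tau]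
  have ha0' : io (a i0) ≠ 0 := fun h0 => ha0 ((hio _).mp h0)
  have hle : I ≤ RingHom.ker tau := by
    rw [hI]
    refine sup_le ?_ ?_
    · refine hs.le.trans (Ideal.span_le.mpr ?_)
      intro x hx
      show tau x = 0
      rw [hfree x (hsf x hx), hio]
      exact hs.ge (Ideal.subset_span hx)
    · rw [Ideal.span_le]
      rintro _ ⟨i, rfl⟩
      show tau (a i * X e + h i) = 0
      rw [map_add, map_mul, hfree _ (ha i), hfree _ (hh i), htX]
      have := (hio _).mpr (hrel i i0)
      rw [map_sub, map_mul, map_mul] at this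
      rw [mul_div_assoc', div_add' _ _ _ ha0', div_eq_zero_iff]
      left
      linear_combination -this
  have hge : RingHom.ker tau ≤ I := by
    intro p hp
    have hJI : J ≤ I := by rw [hI]; exact le_sup_left
    have hbI : ∀ i, a i * X e + h i ∈ I := fun i => by
      rw [hI]; exact Ideal.mem_sup_right (Ideal.subset_span ⟨i, rfl⟩)
    have hA : ∀ i, ∃ N : ℕ, a i ^ N * p ∈ I := by
      intro i
      obtain ⟨N, u, hu, h1⟩ := red_free (ha i) (hh i) p
      have h2 : a i ^ N * p - u ∈ I :=
        (Ideal.span_le.mpr (Set.singleton_subset_iff.mpr (hbI i))) h1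
      have h3 : tau u = 0 := by
        have := hle h2
        rw [RingHom.mem_ker, map_sub, map_mul, RingHom.mem_ker.mp hp, mul_zero, zero_sub, neg_eq_zero] at this
        exact this
      rw [hfree u hu, hio] at h3
      refine ⟨N, ?_⟩
      have := add_mem h2 (hJI h3)
      rwa [sub_add_cancel] at this
    refine hG.colon_pow hht p ?_
    rintro _ (⟨i, rfl⟩ | ⟨i, rfl⟩)
    · exact hA i
    · obtain ⟨N, hN⟩ := hA i
      refine ⟨N, ?_⟩
      have h1 : h i ^ N - (-(X e) * a i) ^ N ∈ I := by
        obtain ⟨c, hc⟩ := sub_dvd_pow_sub_pow (h i) (-(X e) * a i) N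
        rw [hc]
        refine Ideal.mul_mem_right _ _ ?_
        have : h i - -(X e) * a i = a i * X e + h i := by ring
        rw [this]; exact hbI i
      have h2 : h i ^ N * p = (h i ^ N - (-(X e) * a i) ^ N) * p + (-(X e)) ^ N * (a i ^ N * p) := by ring
      rw [h2]
      exact add_mem (Ideal.mul_mem_right _ _ h1) (Ideal.mul_mem_left _ _ hN)
  rw [le_antisymm hle hge]
  exact RingHom.ker_isPrime tau

lemma coeff_low {s : Set (MvPolynomial E K)} {d : ℕ} (hs : ∀ x ∈ s, x.IsHomogeneous d)
    {x : MvPolynomial E K} (hx : x ∈ Ideal.span s) : ∀ m : E →₀ ℕ, m.degree < d → coeff m x = 0 := by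
  induction hx using Submodule.span_induction with
  | mem x hx =>
    intro m hm
    by_contra h0
    have : m.degree = d := by rw [Finsupp.degree_eq_weight_one]; exact hs x hx h0
    omega
  | zero => intro m _; simp
  | add x y _ _ hx hy => intro m hm; rw [coeff_add, hx m hm, hy m hm, add_zero]
  | smul a x _ hx =>
    intro m hm
    rw [smul_eq_mul, coeff_mul]
    refine Finset.sum_eq_zero fun y hy => ?_
    rw [hx y.2, mul_zero]
    rw [Finset.HasAntidiagonal.mem_antidiagonal] at hy
    rw [← hy, map_add] at hm
    omega

lemma not_mem_low {s : Set (MvPolynomial E K)} {d m : ℕ} (hs : ∀ x ∈ s, x.IsHomogeneous d)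
    {x : MvPolynomial E K} (hxm : x.IsHomogeneous m) (hmd : m < d) (h0 : x ≠ 0) : x ∉ Ideal.span s := by
  intro hx
  apply h0
  ext n
  rw [coeff_zero]
  by_contra hn
  have : n.degree = m := by rw [Finsupp.degree_eq_weight_one]; exact hxm hn
  exact hn (coeff_low hs hx n (by omega))

lemma Free.sg' {e : E} (f : E) {p : MvPolynomial E K} (h : Free e p) : Free e (sg f p) := by
  rw [Free, sg_comm, h]

namespace DSys
variable (S : DSys K E V)

/-- hypotheses obtained from 3-connectedness -/
structure Good : Prop where
  nz : ∀ s t, S.n s t ≠ 0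
  con : ∀ f s t, s ≠ f → t ≠ f → pderiv f (S.n s t) ≠ 0
  irr : ∀ e f, e ≠ f → Prime (S.n e f)
  dpos : 1 ≤ S.d

variable {S}

lemma Good.conn (hg : S.Good) : S.Conn := fun s t _ _ => hg.nz s t

lemma Good.pd_notin (hg : S.Good) {e f g s t : E} (hs : s ≠ f) (ht : t ≠ f) :
    pderiv f (S.n s t) ∉ Ideal.span {S.n e g} := by
  refine not_mem_low (d := S.d) (m := S.d - 1) ?_ (S.N_hom _ _).pderiv ?_ (hg.con f s t hs ht)
  · rintro x rfl; exact S.N_hom _ _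
  · have := hg.dpos; omega

lemma Good.h3 (hg : S.Good) {e f : E} (hef : e ≠ f) : HtGE (Ideal.span
    ((Set.range fun u => pderiv f (S.N u (S.w e))) ∪ (Set.range fun u => sg f (S.N u (S.w e))))) 3 := by
  intro P hP hb
  have hb1 : ∀ u, pderiv f (S.N u (S.w e)) ∈ P := fun u => hb (Ideal.subset_span (Or.inl ⟨u, rfl⟩))
  have hb2 : ∀ u, sg f (S.N u (S.w e)) ∈ P := fun u => hb (Ideal.subset_span (Or.inr ⟨u, rfl⟩))
  refine ht_lemma (k := 2) (S.d - 1) (pderiv f (S.n e e)) (hb1 _) (hg.con f e e hef hef)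
    ((S.N_MA _ _).pderiv f) (S.N_hom _ _).pderiv ?_
  intro g hgg
  have hge : g ≠ e := by
    rintro rfl
    rw [pd_comm, n, S.pd_self, map_zero] at hgg
    exact hgg rfl
  have hgf : g ≠ f := by
    rintro rfl
    exact hgg (S.N_MA _ _ g).1.pd
  refine ⟨{pderiv f (S.n g e), sg f (S.n g e)}, ?_, ?_, ?_⟩
  · rintro x (rfl | rfl)
    · exact hb1 _
    · exact hb2 _
  · have hfr : Free g (S.n g e) := by rw [S.n_symm]; exact S.free_N g _
    rintro x (rfl | rfl)
    · exact hfr.pderiv f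
    · exact hfr.sg' f
  · intro P' hP' hb'
    have m1 : pderiv f (S.n g e) ∈ P' := hb' (Ideal.subset_span (Or.inl rfl))
    have m2 : sg f (S.n g e) ∈ P' := hb' (Ideal.subset_span (Or.inr rfl))
    have m3 : S.n g e ∈ P' := by
      rw [(S.N_MA (S.w g) (S.w e) f).2 |> (fun h => (h : S.n g e = _))]
      exact add_mem (Ideal.mul_mem_left _ _ m1) m2
    have hpr : (Ideal.span {S.n g e}).IsPrime :=
      (Ideal.span_singleton_prime (hg.nz g e)).mpr (hg.irr g e hge)
    have hlt : Ideal.span {S.n g e} < P' := by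
      refine lt_of_le_of_ne (Ideal.span_le.mpr (Set.singleton_subset_iff.mpr m3)) fun h => ?_
      rw [← h] at m1
      exact hg.pd_notin hgf hef m1
    have := Ideal.height_add_one_le_of_lt_of_isPrime hlt
    have h1 := htge_one (hg.nz g e) _ hpr le_rfl
    exact (add_le_add_left h1 1).trans this

lemma Good.h4 (hg : S.Good) {e g : E} (hge : g ≠ e) : HtGE (Ideal.span
    ((Set.range fun x : V × V => pderiv e (S.N x.1 x.2)) ∪
      (Set.range fun x : V × V => sg e (S.N x.1 x.2)))) 4 := by
  intro P hP hb
  have hb1 : ∀ u v, pderiv e (S.N u v) ∈ P := fun u v => hb (Ideal.subset_span (Or.inl ⟨(u, v), rfl⟩))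
  have hb2 : ∀ u v, sg e (S.N u v) ∈ P := fun u v => hb (Ideal.subset_span (Or.inr ⟨(u, v), rfl⟩))
  refine ht_lemma (k := 3) (S.d - 1) (pderiv e (S.n g g)) (hb1 _ _) (hg.con e g g hge hge)
    ((S.N_MA _ _).pderiv e) (S.N_hom _ _).pderiv ?_
  intro f hf
  have hfe : f ≠ e := by
    rintro rfl
    exact hf (S.N_MA _ _ f).1.pd
  refine ⟨_, ?_, ?_, hg.h3 hfe⟩
  · rintro _ (⟨u, rfl⟩ | ⟨u, rfl⟩)
    · exact hb1 _ _
    · exact hb2 _ _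
  · rintro _ (⟨u, rfl⟩ | ⟨u, rfl⟩)
    · exact (S.free_N f u).pderiv e
    · exact (S.free_N f u).sg' e

theorem Good.J_prime (hg : S.Good) {e f : E} (hef : e ≠ f) : (S.Jid e).IsPrime := by
  have hpr : (Ideal.span {S.n e f}).IsPrime :=
      (Ideal.span_singleton_prime (hg.nz e f)).mpr (hg.irr e f hef)
  have hdec : ∀ u, S.N u (S.w e) = pderiv f (S.N u (S.w e)) * X f + sg f (S.N u (S.w e)) := fun u => by
    rw [mul_comm]; exact (S.N_MA u (S.w e) f).2
  refine primeP f (Ideal.span {S.n e f}) {S.n e f} rfl ?_ (fun u => pderiv f (S.N u (S.w e)))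
    (fun u => sg f (S.N u (S.w e))) ?_ ?_ (S.w e) (hg.pd_notin hef hef) ?_ (S.Jid e) ?_ 2
    (G2 _ S rfl hg.conn e (hg.nz e e)) (hg.h3 hef)
  · rintro x rfl; exact S.free_N f _
  · exact fun u => (S.N_MA _ _ f).1
  · exact fun u => free_sg f _
  · intro u u'
    have h1 := S.hab2 e f u u'
    have : pderiv f (S.N u (S.w e)) * sg f (S.N u' (S.w e)) -
        pderiv f (S.N u' (S.w e)) * sg f (S.N u (S.w e)) = S.n e f * S.D u' u (S.w f) (S.w e) := by
      rw [← h1]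
      linear_combination pderiv f (S.N u' (S.w e)) * hdec u - pderiv f (S.N u (S.w e)) * hdec u'
    show pderiv f (S.N u (S.w e)) * sg f (S.N u' (S.w e)) -
        pderiv f (S.N u' (S.w e)) * sg f (S.N u (S.w e)) ∈ _
    rw [this]
    exact Ideal.mul_mem_right _ _ (Ideal.mem_span_singleton_self _)
  · simp only [← hdec]
    apply le_antisymm
    · exact le_sup_right
    · refine sup_le ?_ le_rfl
      rw [Ideal.span_le, Set.singleton_subset_iff, S.n_symm]
      exact S.N_mem_J _ e

theorem Good.I_prime (hg : S.Good) {e f : E} (hef : e ≠ f) : (S.Iid).IsPrime := by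
  have hpr := hg.J_prime hef
  have hdec : ∀ u v, S.N u v = pderiv e (S.N u v) * X e + sg e (S.N u v) := fun u v => by
    rw [mul_comm]; exact (S.N_MA u v e).2
  refine primeP e (S.Jid e) _ rfl ?_ (fun x : V × V => pderiv e (S.N x.1 x.2))
    (fun x => sg e (S.N x.1 x.2)) ?_ ?_ (S.w f, S.w f) ?_ ?_ S.Iid ?_ 3
    (G3 _ S rfl hg.conn e (hg.nz e e)) (hg.h4 hef.symm)
  · rintro _ ⟨u, rfl⟩; exact S.free_N e _
  · exact fun u => (S.N_MA _ _ e).1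
  · exact fun u => free_sg e _
  · refine not_mem_low (d := S.d) (m := S.d - 1) ?_ (S.N_hom _ _).pderiv ?_ (hg.con e f f hef.symm hef.symm)
    · rintro _ ⟨u, rfl⟩; exact S.N_hom _ _
    · have := hg.dpos; omega
  · rintro ⟨u, v⟩ ⟨u', v'⟩
    have h1 := S.hab3 e u v u' v'
    have : pderiv e (S.N u v) * sg e (S.N u' v') -
        pderiv e (S.N u' v') * sg e (S.N u v) = S.N u' (S.w e) * S.D (S.w e) u v' v +
      S.N v (S.w e) * S.D u' u (S.w e) v' := by
      rw [← h1]
      linear_combination pderiv e (S.N u' v') * hdec u v - pderiv e (S.N u v) * hdec u' v'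
    show pderiv e (S.N u v) * sg e (S.N u' v') - pderiv e (S.N u' v') * sg e (S.N u v) ∈ _
    rw [this]
    exact add_mem (Ideal.mul_mem_right _ _ (S.N_mem_J _ _)) (Ideal.mul_mem_right _ _ (S.N_mem_J _ _))
  · simp only [← hdec]
    apply le_antisymm
    · exact le_sup_right
    · exact sup_le (S.J_le_I e) le_rfl

end DSys
end PT
end Config


namespace Config
section FT
open MvPolynomial

variable {K : Type} [Field K] {E : Type} [Fintype E] [DecidableEq E]
  {V : Type} [AddCommGroup V] [Module K V]

namespace DSys

/-- `3`-connectedness, in terms of orthogonality with respect to the form -/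
structure Sep (S : DSys K E V) : Prop where
  dpos : 1 ≤ S.d
  c0 : ∀ X Y : Finset E, X ∪ Y = Finset.univ → X.Nonempty → Y.Nonempty →
    ¬ ∀ s ∈ X, ∀ t ∈ Y, S.n s t = 0
  c1 : ∀ (X Y : Finset E) (e f : E), X ∪ Y = Finset.univ → 2 ≤ X.card → 2 ≤ Y.card →
    e ∈ X → f ∈ Y → S.n e f ≠ 0 → ¬ ∀ s ∈ X, ∀ t ∈ Y, S.n e f * S.n s t - S.n e t * S.n s f = 0

variable {S : DSys K E V}

lemma Sep.F0 (h : S.Sep) (s0 t0 : E) : S.n s0 t0 ≠ 0 := by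
  classical
  intro h0
  let A : Finset E := Finset.univ.filter fun t => S.n s0 t ≠ 0
  refine h.c0 (insert s0 A) Aᶜ ?_ ⟨s0, Finset.mem_insert_self _ _⟩ ⟨t0, by simp [A, h0]⟩ ?_
  · ext x; simp only [Finset.mem_union, Finset.mem_insert, Finset.mem_compl, Finset.mem_univ, iff_true]
    tauto
  · intro s hs t ht
    have ht' : S.n s0 t = 0 := by simpa [A] using ht
    rcases Finset.mem_insert.mp hs with rfl | hs
    · exact ht'
    · have hs' : S.n s0 s ≠ 0 := by simpa [A] using hs
      have := S.keyn s s0 t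
      rw [ht', map_zero, mul_zero, mul_zero, zero_sub, zero_eq_neg] at this
      exact (mul_eq_zero.mp this).resolve_right hs'

noncomputable def dt (S : DSys K E V) (e f s t : E) : MvPolynomial E K :=
  S.n e f * S.n s t - S.n e t * S.n s f

lemma pd_dt (e f s t k : E) : S.n e f * (S.psi * pderiv k (S.dt e f s t)) =
    2 * S.n e f * S.n k k * S.dt e f s t -
      (S.dt e f s k * S.dt e f k t + S.n e k * S.n k f * S.dt e f s t) := by
  have h1 := S.keyn k e f
  have h2 := S.keyn k s t
  have h3 := S.keyn k e t
  have h4 := S.keyn k s f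
  simp only [dt, map_sub, pderiv_mul]
  linear_combination S.n e f * (S.n s t * h1 + S.n e f * h2 - S.n s f * h3 - S.n e t * h4)

lemma Sep.F1 (h : S.Sep) {e f s0 t0 : E} (hs0 : s0 ≠ e) (ht0 : t0 ≠ f) : S.dt e f s0 t0 ≠ 0 := by
  classical
  intro h0
  have hef := h.F0 e f
  let A : Finset E := Finset.univ.filter fun t => S.dt e f s0 t ≠ 0
  have hf : f ∈ Aᶜ := by
    have : S.dt e f s0 f = 0 := by rw [dt]; ring
    simp [A, this]
  have ht : t0 ∈ Aᶜ := by simp [A, h0]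
  have he' : e ∈ insert s0 (insert e A) := by simp
  have hs' : s0 ∈ insert s0 (insert e A) := by simp
  refine h.c1 (insert s0 (insert e A)) Aᶜ e f ?_ ?_ ?_ he' hf hef ?_
  · ext x; simp only [Finset.mem_union, Finset.mem_insert, Finset.mem_compl, Finset.mem_univ, iff_true]
    tauto
  · exact Finset.one_lt_card.mpr ⟨s0, hs', e, he', hs0⟩
  · exact Finset.one_lt_card.mpr ⟨t0, ht, f, hf, ht0⟩
  · intro s hs t ht
    have ht' : S.dt e f s0 t = 0 := by simpa [A] using ht
    rcases Finset.mem_insert.mp hs with rfl | hs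
    · exact ht'
    · rcases Finset.mem_insert.mp hs with rfl | hs
      · ring
      · have hs' : S.dt e f s0 s ≠ 0 := by simpa [A] using hs
        have := S.pd_dt e f s0 t s
        rw [ht', map_zero, mul_zero, mul_zero, mul_zero, mul_zero, zero_sub, add_zero, zero_eq_neg] at this
        exact (mul_eq_zero.mp this).resolve_left hs'

lemma Sep.F2 (h : S.Sep) {e f : E} (hef : e ≠ f) : Prime (S.n e f) := by
  apply Irreducible.prime
  have hd := h.dpos
  have hne := h.F0 e f
  have hM : MA (S.n e f) := S.N_MA _ _
  have hunit : ∀ p : MvPolynomial E K, p ≠ 0 → ¬ IsUnit p → ∃ s, degreeOf s p ≠ 0 := by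
    intro p hp hu
    by_contra hcon
    push Not at hcon
    have h1 := eq_C_of_free (fun e => free_iff_degreeOf.mpr (hcon e))
    apply hu
    rw [h1]
    refine (IsUnit.mk0 _ fun h0 => hp ?_).map C
    rw [h1, h0, map_zero]
  refine ⟨?_, ?_⟩
  · intro hu
    have h1 := (S.N_hom (S.w e) (S.w f)).totalDegree hne
    have h2 := MvPolynomial.isUnit_iff_totalDegree_of_isReduced.mp hu
    have h3 : (S.n e f).totalDegree = S.d := h1
    omega
  · intro p q hpq
    by_contra hcon
    push Not at hcon
    have hp0 : p ≠ 0 := by rintro rfl; exact hne (by rw [hpq, zero_mul])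
    have hq0 : q ≠ 0 := by rintro rfl; exact hne (by rw [hpq, mul_zero])
    obtain ⟨s, hs⟩ := hunit p hp0 hcon.1
    obtain ⟨t, ht⟩ := hunit q hq0 hcon.2
    have hdeg : ∀ g, degreeOf g p + degreeOf g q ≤ 1 := fun g => by
      rw [← degreeOf_mul_eq hp0 hq0, ← hpq]; exact hM.degreeOf_le g
    have hqs : Free s q := free_iff_degreeOf.mpr (by have := hdeg s; omega)
    have hpt : Free t p := free_iff_degreeOf.mpr (by have := hdeg t; omega)
    have hfree : ∀ g, Free g (S.n e f) → degreeOf g p = 0 ∧ degreeOf g q = 0 := fun g hg => by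
      have := free_iff_degreeOf.mp hg
      rw [hpq, degreeOf_mul_eq hp0 hq0] at this
      omega
    have hff := hfree f (S.free_N f _)
    have hfe := hfree e (by rw [S.n_symm]; exact S.free_N e _)
    have hse : s ≠ e := by rintro rfl; exact hs hfe.1
    have hsf : s ≠ f := by rintro rfl; exact hs hff.1
    have hte : t ≠ e := by rintro rfl; exact ht hfe.2
    have htf : t ≠ f := by rintro rfl; exact ht hff.2
    have e1 : pderiv s (S.n e f) = pderiv s p * q := by rw [hpq, pderiv_mul, hqs.pd]; ring
    have e2 : pderiv t (S.n e f) = p * pderiv t q := by rw [hpq, pderiv_mul, hpt.pd]; ring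
    have e3 : pderiv s (pderiv t (S.n e f)) = pderiv s p * pderiv t q := by
      rw [e2, pderiv_mul, (hqs.pderiv t).pd]; ring
    have k1 : S.psi * pderiv s (S.n e f) = S.dt e f s s := by rw [S.keyn, dt, S.n_symm s f]; rw [S.n_symm f s]; ring
    have k2 : S.psi * pderiv t (S.n e f) = S.dt e f t t := by rw [S.keyn, dt]; ring
    have k3 := congrArg (pderiv s) k2
    rw [pderiv_mul, S.dpsi] at k3
    have k4 := S.pd_dt e f t t s
    rw [← k3] at k4
    have k5 : S.n e f * (pderiv s (pderiv t (S.n e f))) =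
      pderiv s (S.n e f) * pderiv t (S.n e f) := by rw [e3, e1, e2, hpq]; ring
    have k6 : S.dt e f t s * S.dt e f s t = 0 := by
      have k7 : S.dt e f s s = S.n e f * S.n s s - S.n e s * S.n s f := rfl
      have k8 : S.N (S.w s) (S.w s) = S.n s s := rfl
      rw [k8] at k4
      linear_combination k4 - S.n e f * S.n s s * k2 - S.psi ^ 2 * k5 - S.psi * pderiv s (S.n e f) * k2
        - S.dt e f t t * k1 - S.dt e f t t * k7
    rcases mul_eq_zero.mp k6 with h6 | h6
    · exact h.F1 hte hsf h6
    · exact h.F1 hse htf h6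

theorem Sep.good (h : S.Sep) : S.Good where
  nz := h.F0
  con := fun f s t hs ht h0 => by
    have := h.F1 (e := f) (f := f) hs ht
    apply this
    rw [dt, ← S.keyn, h0, mul_zero]
  irr := fun e f hef => h.F2 hef
  dpos := h.dpos

end DSys
end FT
end Config


namespace Config
section LA
open Matrix

variable {m : Type} [Fintype m] [DecidableEq m]

lemma adj_eq_inv {F : Type} [Field F] {A : Matrix m m F} (hA : A.det ≠ 0) : A.adjugate = A.det • A⁻¹ := by
  rw [Matrix.inv_def, smul_smul, Ring.mul_inverse_cancel _ (IsUnit.mk0 _ hA), one_smul]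

lemma det_two_field {F : Type} [Field F] {A : Matrix m m F} (hA : A.det ≠ 0) (p s q t : m → F) :
    (A + vecMulVec p s + vecMulVec q t).det = A.det * ((1 + s ⬝ᵥ (A⁻¹ *ᵥ p)) * (1 + t ⬝ᵥ (A⁻¹ *ᵥ q))
      - (s ⬝ᵥ (A⁻¹ *ᵥ q)) * (t ⬝ᵥ (A⁻¹ *ᵥ p))) := by
  let U : Matrix m (Fin 2) F := Matrix.of fun i k => ![p i, q i] k
  let W : Matrix (Fin 2) m F := Matrix.of ![s, t]
  have h1 : A + vecMulVec p s + vecMulVec q t = A + U * W := by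
    ext i j
    simp [U, W, Matrix.mul_apply, vecMulVec_apply, Fin.sum_univ_two, add_assoc]
  have h2 : ∀ k l, (W * A⁻¹ * U) k l = (![s, t] k) ⬝ᵥ (A⁻¹ *ᵥ (![p, q] l)) := by
    intro k l
    rw [Matrix.mul_assoc, Matrix.mul_apply]
    simp only [dotProduct]
    refine Finset.sum_congr rfl fun i _ => ?_
    congr 1
    rw [Matrix.mul_apply, mulVec, dotProduct]
    refine Finset.sum_congr rfl fun j _ => ?_
    congr 1
    fin_cases l <;> rfl
  rw [h1, det_add_mul U W (IsUnit.mk0 _ hA), det_fin_two]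
  simp only [Matrix.add_apply, h2]
  simp

lemma det_one_field {F : Type} [Field F] {A : Matrix m m F} (hA : A.det ≠ 0) (p s : m → F) :
    (A + vecMulVec p s).det = A.det + s ⬝ᵥ (A.adjugate *ᵥ p) := by
  have := det_two_field hA p s 0 0
  simp only [vecMulVec_zero, add_zero, mulVec_zero, dotProduct_zero, mul_one, zero_mul, sub_zero] at this
  rw [this, adj_eq_inv hA, smul_mulVec, dotProduct_smul, smul_eq_mul]
  ring

section map
variable {R F : Type} [CommRing R] [CommRing F]
lemma map_vmv (f : R →+* F) (p s : m → R) :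
    f.mapMatrix (vecMulVec p s) = vecMulVec (f ∘ p) (f ∘ s) := by
  ext i j; simp [vecMulVec_apply]

lemma map_form (f : R →+* F) (A : Matrix m m R) (p s : m → R) :
    f (s ⬝ᵥ (A.adjugate *ᵥ p)) = (f ∘ s) ⬝ᵥ ((f.mapMatrix A).adjugate *ᵥ (f ∘ p)) := by
  rw [RingHom.map_dotProduct, ← RingHom.map_adjugate]
  congr 1
  ext i
  simp only [Function.comp]
  rw [RingHom.map_mulVec]
  rfl
end map

variable {R : Type} [CommRing R] [IsDomain R]

lemma det_one_dom {A : Matrix m m R} (hA : A.det ≠ 0) (p s : m → R) :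
    (A + vecMulVec p s).det = A.det + s ⬝ᵥ (A.adjugate *ᵥ p) := by
  let F := FractionRing R
  let f : R →+* F := algebraMap R F
  have hf : Function.Injective f := IsFractionRing.injective R F
  apply hf
  have hA' : (f.mapMatrix A).det ≠ 0 := by
    rw [← RingHom.map_det]; exact fun h => hA (hf (by rw [h, map_zero]))
  have := det_one_field hA' (f ∘ p) (f ∘ s)
  rw [RingHom.map_det, map_add, map_add, map_form, RingHom.map_det, map_vmv]
  exact this

lemma det_two_dom {A : Matrix m m R} (hA : A.det ≠ 0) (p s q t : m → R) :
    A.det * ((A + vecMulVec q t + vecMulVec p s).det - (A + vecMulVec q t).det -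
      (A + vecMulVec p s).det + A.det) = (s ⬝ᵥ (A.adjugate *ᵥ p)) * (t ⬝ᵥ (A.adjugate *ᵥ q)) -
        (s ⬝ᵥ (A.adjugate *ᵥ q)) * (t ⬝ᵥ (A.adjugate *ᵥ p)) := by
  let F := FractionRing R
  let f : R →+* F := algebraMap R F
  have hf : Function.Injective f := IsFractionRing.injective R F
  apply hf
  have hA' : (f.mapMatrix A).det ≠ 0 := by
    rw [← RingHom.map_det]; exact fun h => hA (hf (by rw [h, map_zero]))
  have e1 := det_two_field hA' (f ∘ q) (f ∘ t) (f ∘ p) (f ∘ s)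
  have e2 := det_two_field hA' (f ∘ q) (f ∘ t) 0 0
  have e3 := det_two_field hA' (f ∘ p) (f ∘ s) 0 0
  simp only [vecMulVec_zero, add_zero, mulVec_zero, dotProduct_zero, mul_one, zero_mul, sub_zero] at e2 e3
  have hN : ∀ s p : m → R, f (s ⬝ᵥ (A.adjugate *ᵥ p)) =
      (f.mapMatrix A).det * ((f ∘ s) ⬝ᵥ ((f.mapMatrix A)⁻¹ *ᵥ (f ∘ p))) := by
    intro s p
    rw [map_form, ← smul_eq_mul, ← dotProduct_smul, ← smul_mulVec, ← adj_eq_inv hA']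
  simp only [map_mul, map_add, map_sub, hN, RingHom.map_det, map_vmv, e1, e2, e3]
  ring

lemma det_rank_one (A : Matrix m m R) (p s : m → R) :
    (A + vecMulVec p s).det = A.det + s ⬝ᵥ (A.adjugate *ᵥ p) := by
  let c : R →+* Polynomial R := Polynomial.C
  let B : Matrix m m (Polynomial R) := (-A).charmatrix
  have hB : B.det ≠ 0 := ((-A).charpoly_monic).ne_zero
  have := congrArg (Polynomial.evalRingHom 0) (det_one_dom hB (c ∘ p) (c ∘ s))
  have hBA : (Polynomial.evalRingHom 0).mapMatrix B = A := by
    ext i j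
    by_cases hij : i = j
    · subst hij; simp [B, charmatrix]
    · simp [B, charmatrix, hij]
  have hc : ∀ x : m → R, (Polynomial.evalRingHom 0) ∘ (c ∘ x) = x := by
    intro x; ext i; simp [c]
  rw [RingHom.map_det, map_add, map_add, RingHom.map_det, map_form, map_vmv, hBA, hc, hc] at this
  exact this

end LA
end Config


namespace Config
section Base
open MvPolynomial Matrix

variable {K : Type} [Field K] {E : Type} [Fintype E] [DecidableEq E]

/-- constant vector -/
noncomputable def cv (E : Type) {m : Type} (u : m → K) : m → MvPolynomial E K := fun i => C (u i)

/-- column of the configuration -/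
def vec {r : ℕ} (w : Fin r → E → K) (e : E) : Fin r → K := fun i => w i e

lemma sg_cv {m : Type} (e : E) (u : m → K) : (sg e : MvPolynomial E K →ₐ[K] _).toRingHom ∘ (cv E u) = cv E u := by
  ext1 i; exact sg_C e (u i)

lemma Q_split {r : ℕ} (w : Fin r → E → K) (B : Matrix (Fin r) (Fin r) (MvPolynomial E K))
    (hB : ∀ e i j, Free e (B i j)) (e : E) :
    Qform w + B = (sg e : MvPolynomial E K →ₐ[K] _).toRingHom.mapMatrix (Qform w + B) +
      vecMulVec ((X e : MvPolynomial E K) • cv E (vec w e)) (cv E (vec w e)) := by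
  ext1 i j
  simp only [Matrix.add_apply, RingHom.mapMatrix_apply, Matrix.map_apply, vecMulVec_apply, Pi.smul_apply]
  have h1 : (sg e : MvPolynomial E K →ₐ[K] _).toRingHom (Qform w i j + B i j) = sg e (Qform w i j) + B i j := by
    rw [map_add]
    congr 1
    exact hB e i j
  rw [h1]
  have h2 : sg e (Qform w i j) + X e * (C (w i e) * C (w j e)) = Qform w i j := by
    simp only [Qform, Matrix.of_apply, map_sum, map_mul, sg_C]
    rw [← Finset.add_sum_erase _ _ (Finset.mem_univ e),
      ← Finset.add_sum_erase _ (fun x => C (w i x) * C (w j x) * X x) (Finset.mem_univ e)]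
    rw [sg_X_self]
    have : ∀ x ∈ Finset.univ.erase e, C (w i x) * C (w j x) * sg e (X x) = C (w i x) * C (w j x) * (X x : MvPolynomial E K) := by
      intro x hx
      rw [sg_X_ne (by simpa using hx)]
    rw [Finset.sum_congr rfl this]
    ring
  simp only [cv, vec, smul_eq_mul]
  linear_combination (-1 : MvPolynomial E K) * h2

lemma detQ_aff {r : ℕ} (w : Fin r → E → K) (B : Matrix (Fin r) (Fin r) (MvPolynomial E K))
    (hB : ∀ e i j, Free e (B i j)) (e : E) :
    Aff e (Qform w + B).det ∧ pderiv e (Qform w + B).det =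
      (Qform w + B + vecMulVec (cv E (vec w e)) (cv E (vec w e))).det - (Qform w + B).det := by
  set c := cv E (vec w e) with hc
  set A := Qform w + B with hA
  set A0 := (sg e : MvPolynomial E K →ₐ[K] _).toRingHom.mapMatrix A with hA0
  have hs : A = A0 + vecMulVec ((X e : MvPolynomial E K) • c) c := Q_split w B hB e
  have hs' : A + vecMulVec c c = A0 + vecMulVec (((X e : MvPolynomial E K) + 1) • c) c := by
    rw [add_smul, one_smul, add_vecMulVec, ← add_assoc, ← hs]
  set P := c ⬝ᵥ (A0.adjugate *ᵥ c) with hP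
  have d1 : A.det = X e * P + A0.det := by
    conv_lhs => rw [hs, det_rank_one, mulVec_smul, dotProduct_smul, smul_eq_mul]
    ring
  have d2 : (A + vecMulVec c c).det = (X e + 1) * P + A0.det := by
    rw [hs', det_rank_one, mulVec_smul, dotProduct_smul, smul_eq_mul]
    ring
  have fP : Free e P := by
    have := map_form (sg e : MvPolynomial E K →ₐ[K] _).toRingHom A c c
    rw [sg_cv] at this
    rw [hP, hA0, ← this]
    exact free_sg _ _
  have fA : Free e A0.det := by
    rw [hA0, ← RingHom.map_det]; exact free_sg _ _
  obtain ⟨h1, h2⟩ := aff_of' fP fA d1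
  refine ⟨h1, ?_⟩
  rw [h2, d1, d2]; ring

lemma free_vmv {m : Type} (e : E) (p s : m → K) (i j : m) : Free e (vecMulVec (cv E p) (cv E s) i j) :=
  (Free.C e _).mul (Free.C e _)

variable {r : ℕ} (w : Fin r → E → K)

noncomputable def bN (u v : Fin r → K) : MvPolynomial E K := cv E u ⬝ᵥ ((Qform w).adjugate *ᵥ cv E v)

noncomputable def bD (s t p q : Fin r → K) : MvPolynomial E K :=
  (Qform w + (vecMulVec (cv E q) (cv E t) + vecMulVec (cv E p) (cv E s))).det
    - (Qform w + vecMulVec (cv E q) (cv E t)).det - (Qform w + vecMulVec (cv E p) (cv E s)).det + (Qform w).det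

lemma bN_eq (u v : Fin r → K) : bN w u v = (Qform w + vecMulVec (cv E v) (cv E u)).det - (Qform w).det := by
  rw [det_rank_one, bN]; ring

lemma Q_aff (e : E) : Aff e (Qform w).det ∧ pderiv e (Qform w).det =
      (Qform w + vecMulVec (cv E (vec w e)) (cv E (vec w e))).det - (Qform w).det := by
  have := detQ_aff w 0 (fun e i j => Free.zero e) e
  rwa [add_zero] at this

lemma Q_aff1 (p s : Fin r → K) : MA (Qform w + vecMulVec (cv E p) (cv E s)).det := fun e =>
  (detQ_aff w _ (fun e i j => free_vmv e p s i j) e).1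

lemma Q_aff2 (p s q t : Fin r → K) :
    MA (Qform w + (vecMulVec (cv E p) (cv E s) + vecMulVec (cv E q) (cv E t))).det := fun e =>
  (detQ_aff w _ (fun e i j => (free_vmv e p s i j).add (free_vmv e q t i j)) e).1

lemma Q_symm : (Qform w)ᵀ = Qform w := by
  ext1 i j
  simp only [Qform, transpose_apply, of_apply, mul_comm (w j _)]

lemma bN_symm (u v : Fin r → K) : bN w u v = bN w v u := by
  unfold bN
  rw [dotProduct_mulVec, ← mulVec_transpose, adjugate_transpose, Q_symm, dotProduct_comm]

lemma Q_mulVec (y : Fin r → K) : Qform w *ᵥ cv E y =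
    ∑ g, (X g * C (y ⬝ᵥ vec w g) : MvPolynomial E K) • cv E (vec w g) := by
  ext1 i
  simp only [mulVec, dotProduct, Qform, of_apply, Finset.sum_apply, Pi.smul_apply, smul_eq_mul, cv, vec,
    Finset.sum_mul, map_sum, Finset.mul_sum]
  rw [Finset.sum_comm]
  refine Finset.sum_congr rfl fun g _ => Finset.sum_congr rfl fun j _ => ?_
  simp only [map_mul]; ring

lemma bN_adj (y u : Fin r → K) :
    ∑ g, X g * C (y ⬝ᵥ vec w g) * bN w u (vec w g) = (Qform w).det * C (y ⬝ᵥ u) := by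
  have h1 : (Qform w).adjugate *ᵥ (Qform w *ᵥ cv E y) = (Qform w).det • cv E y := by
    rw [mulVec_mulVec, adjugate_mul, smul_mulVec, one_mulVec]
  have h2 := congrArg (fun z => cv E u ⬝ᵥ z) h1

  rw [Q_mulVec, mulVec_sum, dotProduct_sum, dotProduct_smul] at h2
  have h3 : cv E u ⬝ᵥ cv E y = C (y ⬝ᵥ u) := by
    simp only [dotProduct, cv, map_sum, map_mul]
    exact Finset.sum_congr rfl fun i _ => mul_comm _ _
  rw [h3, smul_eq_mul] at h2
  rw [← h2]
  refine Finset.sum_congr rfl fun g _ => ?_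
  rw [mulVec_smul, dotProduct_smul, smul_eq_mul, bN]

lemma Q_entry_hom (i j : Fin r) : (Qform w i j).IsHomogeneous 1 := by
  simp only [Qform, of_apply]
  refine IsHomogeneous.sum _ _ _ fun e _ => ?_
  have := (isHomogeneous_C E (w i e * w j e)).mul (isHomogeneous_X K e)
  rwa [zero_add] at this

lemma det_hom {n : ℕ} (A : Matrix (Fin n) (Fin n) (MvPolynomial E K)) (hA : ∀ i j, (A i j).IsHomogeneous 1) :
    A.det.IsHomogeneous n := by
  rw [det_apply]
  refine IsHomogeneous.sum _ _ _ fun σ _ => ?_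
  have h := IsHomogeneous.prod Finset.univ (fun i => A (σ i) i) (fun _ => 1) (fun i _ => hA _ _)
  simp only [Finset.sum_const, Finset.card_univ, Fintype.card_fin, smul_eq_mul, mul_one] at h
  rcases Int.units_eq_one_or (Equiv.Perm.sign σ) with hs | hs
  · rw [hs, one_smul]; exact h
  · rw [hs, Units.neg_smul, one_smul]; exact h.neg

end Base
section Base2
open MvPolynomial Matrix

variable {K : Type} [Field K] {E : Type} [Fintype E] [DecidableEq E]
variable {n : ℕ} (w : Fin (n+1) → E → K)

lemma bN_hom (u v : Fin (n+1) → K) : (bN w u v).IsHomogeneous n := by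
  simp only [bN, dotProduct, mulVec, cv]
  refine IsHomogeneous.sum _ _ _ fun i _ => ?_
  have := (isHomogeneous_C E (u i)).mul
    (φ := C (u i)) (ψ := ∑ j, (Qform w).adjugate i j * C (v j)) (n := n) ?_
  · rwa [zero_add] at this
  refine IsHomogeneous.sum _ _ _ fun j _ => ?_
  have h2 : ((Qform w).adjugate i j).IsHomogeneous n := by
    rw [adjugate_fin_succ_eq_det_submatrix]
    have hd := det_hom ((Qform w).submatrix j.succAbove i.succAbove) fun _ _ => Q_entry_hom w _ _
    rcases neg_one_pow_eq_or (MvPolynomial E K) (j + i : ℕ) with h | h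
    · rw [h, one_mul]; exact hd
    · rw [h, neg_one_mul]; exact hd.neg
  have := h2.mul (isHomogeneous_C E (v j))
  rwa [add_zero] at this

noncomputable def baseSys (hne : (Qform w).det ≠ 0) : DSys K E (Fin (n+1) → K) where
  w := vec w
  psi := (Qform w).det
  N := bN w
  D := bD w
  d := n
  U0 := ⊥
  psi_ne := hne
  psi_MA := fun e => (Q_aff w e).1
  N_MA := fun u v => by
    rw [bN_eq]
    exact (Q_aff1 w _ _).sub fun e => (Q_aff w e).1
  D_MA := fun s t p q e =>
    ((((Q_aff2 w q t p s) e).sub (Q_aff1 w q t e)).sub (Q_aff1 w p s e)).add (Q_aff w e).1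
  N_add := fun u u' v => by
    have : cv E (u + u') = cv E u + cv E u' := by ext1 i; simp [cv]
    rw [bN, this, add_dotProduct]; rfl
  N_smul := fun c u v => by
    have : cv E (c • u) = (C c : MvPolynomial E K) • cv E u := by ext1 i; simp [cv]
    rw [bN, this, smul_dotProduct]; rfl
  N_symm := bN_symm w
  jac := fun s t p q => by
    have := det_two_dom hne (cv E p) (cv E s) (cv E q) (cv E t)
    rw [bD, ← add_assoc, this]; rfl
  dpsi := fun e => by rw [(Q_aff w e).2, bN_eq]
  dN := fun e u v => by
    rw [bN_eq, map_sub, (Q_aff w e).2, (detQ_aff w _ (fun e i j => free_vmv e v u i j) e).2, bD, ← add_assoc]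
    ring
  N_hom := bN_hom w
  N_U0 := fun u hu v => by
    rw [Submodule.mem_bot] at hu
    subst hu
    have : cv E (0 : Fin (n+1) → K) = 0 := by ext1 i; simp [cv]
    rw [bN, this, zero_dotProduct]
  adj := fun φ _ u => by
    obtain ⟨y, hy⟩ : ∃ y : Fin (n+1) → K, ∀ v, φ v = y ⬝ᵥ v := by
      refine ⟨fun i => φ (Pi.single i 1), fun v => ?_⟩
      rw [LinearMap.pi_apply_eq_sum_univ φ v]
      simp only [dotProduct, smul_eq_mul, mul_comm]
      refine Finset.sum_congr rfl fun i _ => ?_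
      congr 2; ext j; simp [Pi.single_apply, eq_comm]
    simp only [hy]
    exact bN_adj w y u

end Base2
end Config


namespace Config
section CB
open MvPolynomial Matrix

variable {K : Type} [Field K] {E : Type} [Fintype E] [DecidableEq E]

lemma coeff_comm {R : Type} [CommRing R] {m n : Type} [Fintype m] [DecidableEq m] [Fintype n] [DecidableEq n]
    (A : Matrix m n R) (B : Matrix n m R) :
    (1 + (Polynomial.X : Polynomial R) • (A * B).map Polynomial.C).det =
    (1 + (Polynomial.X : Polynomial R) • (B * A).map Polynomial.C).det := by
  rw [Matrix.map_mul, Matrix.map_mul, ← Matrix.smul_mul, det_one_add_mul_comm, Matrix.mul_smul]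

lemma det_sub_univ {R : Type} [CommRing R] {n : Type} [Fintype n] [DecidableEq n] (M : Matrix n n R) :
    (M.submatrix (Subtype.val : ((Finset.univ : Finset n) : Type) → n) Subtype.val).det = M.det := by
  let e : ((Finset.univ : Finset n) : Type) ≃ n := ⟨Subtype.val, fun x => ⟨x, Finset.mem_univ x⟩, fun _ => rfl, fun _ => rfl⟩
  exact det_submatrix_equiv_self e M

theorem psi_eq_det {r : ℕ} (w : Fin r → E → K) : psi w = (Qform w).det := by
  let A : Matrix (Fin r) E (MvPolynomial E K) := Matrix.of fun i e => C (w i e)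
  let B : Matrix E (Fin r) (MvPolynomial E K) := Matrix.of fun e j => X e * C (w j e)
  have hQ : Qform w = A * B := by
    ext1 i j
    simp only [Qform, of_apply, Matrix.mul_apply, A, B]
    refine Finset.sum_congr rfl fun e _ => ?_
    rw [map_mul]; ring
  have h := congrArg (fun p => p.coeff r) (coeff_comm A B)
  simp only [coeff_det_one_add_X_smul_eq_sum_minors] at h
  have h1 : (Finset.univ : Finset (Fin r)).powersetCard r = {Finset.univ} := by
    have := Finset.powersetCard_self (Finset.univ : Finset (Fin r))
    rwa [Finset.card_fin] at this
  rw [h1, Finset.sum_singleton, ← hQ] at h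
  rw [det_sub_univ] at h
  rw [h, psi]
  refine Finset.sum_congr rfl fun s hs => ?_
  have hc : s.card = r := (Finset.mem_powersetCard.mp hs).2
  set σ := (Finset.equivFinOfCardEq hc) with hσ
  rw [cSq, dif_pos hc]
  rw [← det_submatrix_equiv_self σ.symm]
  have h3 : ((B * A).submatrix (Subtype.val : s → E) Subtype.val).submatrix σ.symm σ.symm =
     (B.submatrix (fun j => (σ.symm j : E)) id) * (A.submatrix id (fun j => (σ.symm j : E))) := by
    ext1 i j
    simp [Matrix.mul_apply]
  have hA : (A.submatrix id (fun j => (σ.symm j : E))).det = C (det (of fun i j : Fin r => w i (σ.symm j : E))) := by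
    rw [RingHom.map_det]; congr 1
  have hB : (B.submatrix (fun j => (σ.symm j : E)) id).det = (∏ j, X (σ.symm j : E)) *
      (A.submatrix id (fun j => (σ.symm j : E))).det := by
    rw [← det_transpose (A.submatrix _ _), ← det_mul_column]
    congr 1
  have hP : ∏ j, (X (σ.symm j : E) : MvPolynomial E K) = ∏ e ∈ s, X e := by
    rw [← Finset.prod_coe_sort s]; exact Equiv.prod_comp σ.symm (fun e => (X (e : E) : MvPolynomial E K))
  rw [h3, det_mul, hB, hA, hP, map_pow]
  ring

end CB
end Config


namespace Config
section RK
open MvPolynomial Matrix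

section field
variable {F : Type} [Field F] {r : ℕ}

lemma orth_dim {A : Matrix (Fin r) (Fin r) F} (hA : IsUnit A) (U V : Submodule F (Fin r → F))
    (h : ∀ x ∈ U, ∀ y ∈ V, x ⬝ᵥ (A *ᵥ y) = 0) : Module.finrank F U + Module.finrank F V ≤ r := by
  have h1 := Subspace.finrank_add_finrank_dualAnnihilator_eq U
  rw [Module.finrank_fin_fun] at h1
  let g : (Fin r → F) →ₗ[F] Module.Dual F (Fin r → F) :=
    LinearMap.mk₂ F (fun y x => x ⬝ᵥ (A *ᵥ y))
      (by intro a b c; rw [mulVec_add, dotProduct_add])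
      (by intro a b c; rw [mulVec_smul, dotProduct_smul])
      (by intro a b c; rw [add_dotProduct])
      (by intro a b c; rw [smul_dotProduct])
  have hg : Function.Injective g := by
    rw [injective_iff_map_eq_zero]
    intro y hy
    have : A *ᵥ y = 0 := by
      ext i
      have := congrArg (fun φ => φ (Pi.single i 1)) hy
      simpa [g] using this
    exact Matrix.mulVec_injective_of_isUnit hA (by rw [this, mulVec_zero])
  have h2 : V.map g ≤ U.dualAnnihilator := by
    rintro _ ⟨y, hy, rfl⟩
    rw [Submodule.mem_dualAnnihilator]
    intro x hx
    exact h x hx y hy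
  have h3 := Submodule.finrank_mono h2
  rw [← (Submodule.equivMapOfInjective g hg V).finrank_eq] at h3
  omega

lemma ker_dim (V : Submodule F (Fin r → F)) (φ : (Fin r → F) →ₗ[F] F) :
    Module.finrank F V ≤ Module.finrank F (V ⊓ LinearMap.ker φ : Submodule F (Fin r → F)) + 1 := by
  have h1 := Submodule.finrank_sup_add_finrank_inf_eq V (LinearMap.ker φ)
  have h2 := LinearMap.finrank_range_add_finrank_ker φ
  have h3 := Submodule.finrank_le (LinearMap.range φ)
  have h4 := Submodule.finrank_le (V ⊔ LinearMap.ker φ)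
  rw [Module.finrank_self] at h3
  omega

end field

variable {K : Type} [Field K] {E : Type} [Fintype E] [DecidableEq E]
variable {r : ℕ} (w : Fin r → E → K)

/-- dimension of the span of the columns in `S` -/
noncomputable def rk (S : Finset E) : ℕ :=
  Module.finrank K (Submodule.span K (Set.range fun e : {x : E // x ∈ S} => vec w e))

lemma rkOn_eq {W : Submodule K (E → K)} (hw : IsBasisOf w W) (S : Finset E) : rkOn W S = rk w S := by
  let M : Matrix (Fin r) {x : E // x ∈ S} K := Matrix.of fun i e => w i e
  have h1 : rkOn W S = M.rank := by
    rw [rkOn, ← hw.2, Submodule.map_span, ← Set.range_comp, Matrix.rank_eq_finrank_span_row]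
    rfl
  rw [h1, Matrix.rank_eq_finrank_span_cols]
  rfl

lemma rk_mono {S T : Finset E} (h : S ⊆ T) : rk w S ≤ rk w T := by
  refine Submodule.finrank_mono (Submodule.span_mono ?_)
  rintro _ ⟨e, rfl⟩
  exact ⟨⟨e, h e.2⟩, rfl⟩

lemma rk_le_card (S : Finset E) : rk w S ≤ S.card := by
  have := finrank_range_le_card (R := K) (fun e : {x : E // x ∈ S} => vec w e)
  rwa [Fintype.card_coe] at this

lemma rk_univ (hw : LinearIndependent K w) : rk w Finset.univ = r := by
  have h := rkOn_eq w (W := Submodule.span K (Set.range w)) ⟨hw, rfl⟩ Finset.univ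
  have hinj : Function.Injective (LinearMap.funLeft K K (fun e : {x : E // x ∈ Finset.univ} => (e : E))) := by
    intro a b hab
    ext e
    exact congrFun hab ⟨e, Finset.mem_univ e⟩
  rw [← h, rkOn, ← (Submodule.equivMapOfInjective _ hinj _).finrank_eq, finrank_span_eq_card hw, Fintype.card_fin]

lemma vec_span (hw : LinearIndependent K w) : Submodule.span K (Set.range (vec w)) = ⊤ := by
  apply Submodule.eq_top_of_finrank_eq
  rw [Module.finrank_fin_fun]
  refine Eq.trans ?_ (rk_univ w hw)
  rw [rk]
  have : Set.range (vec w) = Set.range (fun e : {x : E // x ∈ Finset.univ} => vec w e) := ?_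
  · rw [this]
  ext x
  constructor
  · rintro ⟨e, rfl⟩; exact ⟨⟨e, Finset.mem_univ e⟩, rfl⟩
  · rintro ⟨e, rfl⟩; exact ⟨e, rfl⟩

lemma det_ne (hw : LinearIndependent K w) : (Qform w).det ≠ 0 := by
  classical
  obtain ⟨κ, a, ha, hs, hl⟩ := exists_linearIndependent' K (vec w)
  rw [vec_span w hw] at hs
  have : Finite κ := Finite.of_injective a ha
  have : Fintype κ := Fintype.ofFinite κ
  have hc : Fintype.card κ = r := by
    have := finrank_span_eq_card hl
    rw [hs, finrank_top, Module.finrank_fin_fun] at this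
    exact this.symm
  let σ : Fin r ≃ κ := (Fintype.equivFinOfCardEq hc).symm
  let P : Matrix (Fin r) (Fin r) K := Matrix.of fun i k => w i (a (σ k))
  have hP : IsUnit P := by
    rw [← Matrix.linearIndependent_cols_iff_isUnit]
    exact hl.comp σ σ.injective
  let x : E → K := fun e => if e ∈ Finset.univ.image (a ∘ σ) then 1 else 0
  intro h0
  have h1 := congrArg (MvPolynomial.eval x) h0
  rw [map_zero, RingHom.map_det] at h1
  have h2 : (MvPolynomial.eval x).mapMatrix (Qform w) = P * Pᵀ := by
    ext1 i j
    simp only [RingHom.mapMatrix_apply, map_apply, Qform, of_apply, map_sum, map_mul, eval_C, eval_X,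
      Matrix.mul_apply, transpose_apply, P]
    simp only [x, mul_ite, mul_one, mul_zero]
    rw [← Finset.sum_filter, Finset.filter_mem_eq_inter, Finset.univ_inter, Finset.sum_image]
    · rfl
    · intro p _ q _ hpq
      exact (ha.comp σ.injective) hpq
  rw [h2, det_mul, det_transpose] at h1
  exact ((Matrix.isUnit_iff_isUnit_det P).mp hP).ne_zero (mul_self_eq_zero.mp h1)

abbrev FF (K E : Type) [Field K] := FractionRing (MvPolynomial E K)

/-- columns over the fraction field -/
noncomputable def fv (e : E) : Fin r → FF K E := (algebraMap (MvPolynomial E K) (FF K E)) ∘ cv E (vec w e)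

noncomputable def fspan (S : Finset E) : Submodule (FF K E) (Fin r → FF K E) :=
  Submodule.span (FF K E) (Set.range fun e : {x : E // x ∈ S} => fv w e)

lemma rk_le_fspan (S : Finset E) : rk w S ≤ Module.finrank (FF K E) (fspan w S) := by
  obtain ⟨κ, a, ha, hs, hl⟩ := exists_linearIndependent' K (fun e : {x : E // x ∈ S} => vec w e)
  have : Finite κ := Finite.of_injective a ha
  have : Fintype κ := Fintype.ofFinite κ
  rw [rk, ← hs, finrank_span_eq_card hl]
  have h2 : LinearIndependent (FF K E) (fun k => fv w (a k)) := by
    have h1 := (linearIndependent_algebraMap_comp_iff (S := FF K E)).mpr hl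
    have heq : (fun k => fv w (a k)) = fun i => (algebraMap K (FF K E)) ∘ ((fun e : {x : E // x ∈ S} => vec w e) ∘ a) i := by
      ext k i
      simp only [fv, Function.comp, cv]
      rw [IsScalarTower.algebraMap_apply K (MvPolynomial E K) (FF K E)]
      rfl
    rw [heq]
    exact h1
  rw [← finrank_span_eq_card h2]
  refine Submodule.finrank_mono (Submodule.span_mono ?_)
  rintro _ ⟨k, rfl⟩
  exact ⟨a k, rfl⟩

lemma fv_form (s t : E) : fv w s ⬝ᵥ (((algebraMap (MvPolynomial E K) (FF K E)).mapMatrix (Qform w)).adjugate *ᵥ fv w t) =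
    algebraMap _ (FF K E) (bN w (vec w s) (vec w t)) := by
  rw [bN, map_form]; rfl

lemma adj_unit (hne : (Qform w).det ≠ 0) :
    IsUnit ((algebraMap (MvPolynomial E K) (FF K E)).mapMatrix (Qform w)).adjugate := by
  rw [Matrix.isUnit_iff_isUnit_det, det_adjugate, ← RingHom.map_det]
  refine IsUnit.pow _ (IsUnit.mk0 _ ?_)
  intro h
  exact hne (IsFractionRing.injective (MvPolynomial E K) (FF K E) (by rw [h, map_zero]))

lemma rk_zero_block (hne : (Qform w).det ≠ 0) (X Y : Finset E)
    (h : ∀ s ∈ X, ∀ t ∈ Y, bN w (vec w s) (vec w t) = 0) : rk w X + rk w Y ≤ r := by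
  refine (add_le_add (rk_le_fspan w X) (rk_le_fspan w Y)).trans (orth_dim (adj_unit w hne) _ _ ?_)
  intro x hx y hy
  induction hx using Submodule.span_induction with
  | zero => rw [zero_dotProduct]
  | add a b _ _ ha hb => rw [add_dotProduct, ha, hb, add_zero]
  | smul c a _ ha => rw [smul_dotProduct, ha, smul_zero]
  | mem x hx =>
    obtain ⟨s, rfl⟩ := hx
    induction hy using Submodule.span_induction with
    | zero => rw [mulVec_zero, dotProduct_zero]
    | add a b _ _ ha hb => rw [mulVec_add, dotProduct_add, ha, hb, add_zero]
    | smul c a _ ha => rw [mulVec_smul, dotProduct_smul, ha, smul_zero]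
    | mem y hy =>
      obtain ⟨t, rfl⟩ := hy
      rw [fv_form, h s s.2 t t.2, map_zero]

lemma rk_one_block (hne : (Qform w).det ≠ 0) (X Y : Finset E) (e f : E)
    (hef : bN w (vec w e) (vec w f) ≠ 0)
    (h : ∀ s ∈ X, ∀ t ∈ Y, bN w (vec w e) (vec w f) * bN w (vec w s) (vec w t)
      - bN w (vec w e) (vec w t) * bN w (vec w s) (vec w f) = 0) : rk w X + rk w Y ≤ r + 1 := by
  set A := ((algebraMap (MvPolynomial E K) (FF K E)).mapMatrix (Qform w)).adjugate with hA
  let φ : (Fin r → FF K E) →ₗ[FF K E] FF K E :=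
    { toFun := fun y => fv w e ⬝ᵥ (A *ᵥ y)
      map_add' := by intro a b; rw [mulVec_add, dotProduct_add]
      map_smul' := by intro a b; rw [mulVec_smul, dotProduct_smul]; rfl }
  have key : ∀ s ∈ X, ∀ y ∈ fspan w Y, (fv w e ⬝ᵥ (A *ᵥ fv w f)) * (fv w s ⬝ᵥ (A *ᵥ y)) =
      (fv w e ⬝ᵥ (A *ᵥ y)) * (fv w s ⬝ᵥ (A *ᵥ fv w f)) := by
    intro s hs y hy
    induction hy using Submodule.span_induction with
    | zero => rw [mulVec_zero, dotProduct_zero, dotProduct_zero]; ring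
    | add a b _ _ ha hb => rw [mulVec_add, dotProduct_add, dotProduct_add, mul_add, ha, hb]; ring
    | smul c a _ ha =>
      rw [mulVec_smul, dotProduct_smul, dotProduct_smul, smul_eq_mul, smul_eq_mul]
      linear_combination c * ha
    | mem y hy =>
      obtain ⟨t, rfl⟩ := hy
      have := congrArg (algebraMap _ (FF K E)) (h s hs t t.2)
      simp only [map_sub, map_mul, map_zero, ← fv_form] at this
      exact sub_eq_zero.mp this
  have h1 := orth_dim (adj_unit w hne) (fspan w X) (fspan w Y ⊓ LinearMap.ker φ) ?_
  · have h2 := ker_dim (fspan w Y) φ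
    have h3 := rk_le_fspan w X
    have h4 := rk_le_fspan w Y
    omega
  · rintro x hx y ⟨hy, hy'⟩
    have hy2 : fv w e ⬝ᵥ (A *ᵥ y) = 0 := hy'
    induction hx using Submodule.span_induction with
    | zero => rw [zero_dotProduct]
    | add a b _ _ ha hb => rw [add_dotProduct, ha, hb, add_zero]
    | smul c a _ ha => rw [smul_dotProduct, ha, smul_zero]
    | mem x hx =>
      obtain ⟨s, rfl⟩ := hx
      have := key s s.2 y hy
      rw [hy2, zero_mul] at this
      refine (mul_eq_zero.mp this).resolve_left ?_
      rw [fv_form]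
      intro h0
      exact hef (IsFractionRing.injective (MvPolynomial E K) (FF K E) (by rw [h0, map_zero]))

end RK

section SepS
open MvPolynomial Matrix
variable {K : Type} [Field K] {E : Type} [Fintype E] [DecidableEq E]
variable {n : ℕ} (w : Fin (n+1) → E → K)

lemma base_sep {W : Submodule K (E → K)} (hw : IsBasisOf w W) (h3 : ThreeConnected W) (hn : 1 ≤ n) :
    (baseSys w (det_ne w hw.1)).Sep := by
  have hu := rk_univ w hw.1
  have k1 : ∀ S : Finset E, 1 ≤ S.card → 1 ≤ Sᶜ.card → n + 2 ≤ rk w S + rk w Sᶜ := by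
    intro S h1 h2
    by_contra hcon
    refine (h3 S).1 ⟨?_, h1, h2⟩
    rw [rkOn_eq w hw, rkOn_eq w hw, rkOn_eq w hw, hu]; omega
  have k2 : ∀ S : Finset E, 2 ≤ S.card → 2 ≤ Sᶜ.card → n + 3 ≤ rk w S + rk w Sᶜ := by
    intro S h1 h2
    by_contra hcon
    refine (h3 S).2 ⟨?_, h1, h2⟩
    rw [rkOn_eq w hw, rkOn_eq w hw, rkOn_eq w hw, hu]; omega
  have sub : ∀ X Y : Finset E, X ∪ Y = Finset.univ → Xᶜ ⊆ Y := by
    intro X Y h x hx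
    have := h ▸ Finset.mem_univ x
    rcases Finset.mem_union.mp this with h | h
    · exact absurd h (Finset.mem_compl.mp hx)
    · exact h
  have full : ∀ X : Finset E, Xᶜ.card = 0 → rk w X = n + 1 := by
    intro X h
    rw [Finset.card_eq_zero, Finset.compl_eq_empty_iff] at h
    rw [h, hu]
  refine ⟨hn, ?_, ?_⟩
  · intro X Y hXY hX hY h
    have hr := rk_zero_block w (det_ne w hw.1) X Y h
    have cX := hX.card_pos
    have cY := hY.card_pos
    have m1 := rk_mono w (sub X Y hXY)
    have m2 := rk_mono w (sub Y X (by rw [Finset.union_comm, hXY]))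
    by_cases h1 : Xᶜ.card = 0
    · by_cases h2 : Yᶜ.card = 0
      · rw [full X h1, full Y h2] at hr; omega
      · have := k1 Y cY (by omega); omega
    · have := k1 X cX (by omega); omega
  · intro X Y e f hXY hX hY _ _ hef h
    have hr := rk_one_block w (det_ne w hw.1) X Y e f hef h
    have m1 := rk_mono w (sub X Y hXY)
    have m2 := rk_mono w (sub Y X (by rw [Finset.union_comm, hXY]))
    have big : ∀ X : Finset E, 2 ≤ X.card → Xᶜ.card < 2 → n + 1 ≤ rk w X := by
      intro X h1 h2
      by_cases h0 : Xᶜ.card = 0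
      · rw [full X h0]
      · have := k1 X (by omega) (by omega)
        have := rk_le_card w Xᶜ
        omega
    by_cases h1 : Xᶜ.card < 2
    · by_cases h2 : Yᶜ.card < 2
      · have := big X hX h1
        have := big Y hY h2
        omega
      · have := k2 Y hY (by omega); omega
    · have := k2 X hX (by omega); omega

end SepS
end Config


namespace Config
section Fin
open MvPolynomial Matrix
variable {K : Type} [Field K] {E : Type} [Fintype E] [DecidableEq E]

lemma emb_eq {n : ℕ} (f : Fin n ↪ Fin (n+1)) : ∃ (i : Fin (n+1)) (σ : Equiv.Perm (Fin n)),
    (f : Fin n → Fin (n+1)) = i.succAbove ∘ σ := by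
  have hns : ¬ Function.Surjective f := by
    intro hs
    have := Fintype.card_le_of_surjective f hs
    simp at this
  obtain ⟨i, hi⟩ := not_forall.mp hns
  have : ∀ k, ∃ z, i.succAbove z = f k := fun k => Fin.exists_succAbove_eq fun h => hi ⟨k, h⟩
  choose σ hσ using this
  have hinj : Function.Injective σ := by
    intro a b hab
    apply f.injective
    rw [← hσ, ← hσ, hab]
  refine ⟨i, Equiv.ofBijective σ (Finite.injective_iff_bijective.mp hinj), ?_⟩
  ext1 k
  exact (hσ k).symm

variable {n : ℕ} (w : Fin (n+1) → E → K)

lemma cv_single (i : Fin (n+1)) : cv E (Pi.single i (1 : K)) = Pi.single i 1 := by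
  ext1 j
  by_cases h : j = i
  · subst h; simp [cv]
  · simp [cv, h]

lemma bN_single (i j : Fin (n+1)) : bN w (Pi.single i 1) (Pi.single j 1) = (Qform w).adjugate i j := by
  rw [bN, cv_single, cv_single]; simp

lemma minor_eq (i j : Fin (n+1)) : ((Qform w).submatrix j.succAbove i.succAbove).det =
    (-1) ^ (j + i : ℕ) * (Qform w).adjugate i j := by
  rw [adjugate_fin_succ_eq_det_submatrix, ← mul_assoc, ← mul_pow]; simp

lemma minorIdeal_eq (hne : (Qform w).det ≠ 0) : minorIdeal w = (baseSys w hne).Iid := by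
  apply le_antisymm
  · rw [minorIdeal, Ideal.span_le]
    rintro _ ⟨f, g, rfl⟩
    obtain ⟨i, σ, hf⟩ := emb_eq (n := n) f
    obtain ⟨j, τ, hg⟩ := emb_eq (n := n) g
    have h1 : (Qform w).submatrix f g =
        (((Qform w).submatrix i.succAbove j.succAbove).submatrix σ id).submatrix id τ := by
      rw [hf, hg]; rfl
    have h2 : ((Qform w).submatrix f g).det = _ :=
      (congrArg Matrix.det h1).trans (det_permute' τ _)
    rw [SetLike.mem_coe, h2]
    refine Ideal.mul_mem_left _ _ ?_
    rw [det_permute]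
    refine Ideal.mul_mem_left _ _ ?_
    rw [minor_eq]
    refine Ideal.mul_mem_left _ _ ?_
    rw [← bN_single]
    exact (baseSys w hne).N_mem_I _ _
  · rw [DSys.Iid, Ideal.span_le]
    rintro _ ⟨⟨u, v⟩, rfl⟩
    change bN w u v ∈ minorIdeal w
    simp only [bN, dotProduct, mulVec]
    refine Ideal.sum_mem _ fun i _ => Ideal.mul_mem_left _ _ (Ideal.sum_mem _ fun j _ => Ideal.mul_mem_right _ _ ?_)
    rw [adjugate_fin_succ_eq_det_submatrix]
    refine Ideal.mul_mem_left _ _ (Ideal.subset_span ?_)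
    exact ⟨⟨j.succAbove, Fin.succAbove_right_injective⟩, ⟨i.succAbove, Fin.succAbove_right_injective⟩, rfl⟩

lemma jac_le (hne : (Qform w).det ≠ 0) : jacIdeal w ≤ (baseSys w hne).Iid := by
  set S := baseSys w hne with hS
  have hp : psi w = S.psi := psi_eq_det w
  rw [jacIdeal, Ideal.span_le, hp]
  rintro _ (h | ⟨e, rfl⟩)
  · rw [Set.mem_singleton_iff] at h
    subst h
    have := bN_adj w (Pi.single 0 1) (Pi.single 0 1)
    rw [single_dotProduct, Pi.single_eq_same, one_mul, map_one, mul_one] at this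
    change (Qform w).det ∈ S.Iid
    rw [← this]
    exact Ideal.sum_mem _ fun g _ => Ideal.mul_mem_left _ _ (S.N_mem_I _ _)
  · change pderiv e S.psi ∈ S.Iid
    rw [S.dpsi]
    exact S.N_mem_I _ _

lemma le_of_jac_le (hw : LinearIndependent K w) (hne : (Qform w).det ≠ 0) (P : Ideal (MvPolynomial E K)) (hP : P.IsPrime)
    (hJ : jacIdeal w ≤ P) : (baseSys w hne).Iid ≤ P := by
  set S := baseSys w hne with hS
  have hp : psi w = S.psi := psi_eq_det w
  have h1 : S.psi ∈ P := hJ (Ideal.subset_span (Or.inl hp.symm))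
  have h2 : ∀ e, S.n e e ∈ P := by
    intro e
    have : pderiv e (psi w) ∈ P := hJ (Ideal.subset_span (Or.inr ⟨e, rfl⟩))
    rw [hp, S.dpsi] at this
    exact this
  have h3 : ∀ e f, S.n e f ∈ P := by
    intro e f
    have h := S.keyn e f f
    rw [S.n_symm f e] at h
    apply hP.mem_of_pow_mem 2
    have : S.n e f ^ 2 = S.n e e * S.n f f - S.psi * pderiv e (S.n f f) := by rw [h]; ring
    rw [this]
    exact P.sub_mem (P.mul_mem_right _ (h2 e)) (P.mul_mem_right _ h1)
  have h4 : ∀ u f, S.N u (vec w f) ∈ P := by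
    intro u f
    have hu : u ∈ Submodule.span K (Set.range (vec w)) := by rw [vec_span w hw]; trivial
    induction hu using Submodule.span_induction with
    | zero => rw [S.N_U0 0 (Submodule.zero_mem _)]; exact P.zero_mem
    | add a b _ _ ha hb => rw [S.N_add]; exact P.add_mem ha hb
    | smul c a _ ha => rw [S.N_smul]; exact P.mul_mem_left _ ha
    | mem x hx => obtain ⟨e, rfl⟩ := hx; exact h3 e f
  rw [DSys.Iid, Ideal.span_le]
  rintro _ ⟨⟨u, v⟩, rfl⟩
  change S.N u v ∈ P
  rw [S.N_symm]
  have hv : v ∈ Submodule.span K (Set.range (vec w)) := by rw [vec_span w hw]; trivial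
  induction hv using Submodule.span_induction with
  | zero => rw [S.N_U0 0 (Submodule.zero_mem _)]; exact P.zero_mem
  | add a b _ _ ha hb => rw [S.N_add]; exact P.add_mem ha hb
  | smul c a _ ha => rw [S.N_smul]; exact P.mul_mem_left _ ha
  | mem x hx => obtain ⟨e, rfl⟩ := hx; rw [S.N_symm]; exact h4 u e

lemma final_aux {W : Submodule K (E → K)} (hw : IsBasisOf w W) (h3 : ThreeConnected W) (hn : 1 ≤ n) :
    (minorIdeal w).IsPrime ∧ ∃! P : Ideal (MvPolynomial E K), P ∈ (jacIdeal w).minimalPrimes := by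
  have hne := det_ne w hw.1
  have hcard : 1 < Fintype.card E := by
    have h1 := rk_le_card w Finset.univ
    rw [rk_univ w hw.1, Finset.card_univ] at h1
    omega
  obtain ⟨e, f, hef⟩ := Fintype.exists_pair_of_one_lt_card hcard
  have hprime : (baseSys w hne).Iid.IsPrime := (DSys.Sep.good (base_sep w hw h3 hn)).I_prime hef
  refine ⟨by rw [minorIdeal_eq w hne]; exact hprime, (baseSys w hne).Iid, ⟨⟨hprime, jac_le w hne⟩, ?_⟩, ?_⟩
  · rintro P ⟨hP, hJ⟩ _
    exact le_of_jac_le w hw.1 hne P hP hJ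
  · rintro P ⟨⟨hP, hJ⟩, hmin⟩
    have h1 := le_of_jac_le w hw.1 hne P hP hJ
    exact le_antisymm (hmin ⟨hprime, jac_le w hne⟩ h1) h1

end Fin
end Config


namespace Config

variable {K : Type} [Field K] {E : Type} [Fintype E] [DecidableEq E]

/-- **Theorem (Integrality for 3-connected matroids).**
Let `W ⊆ K^E` be a realization of a `3`-connected matroid of rank at least `2`.
Then the ideal `M_W` of submaximal minors of `Q_W` is prime (the second degeneracy
scheme is integral), and the Jacobian ideal `J_W` has a unique minimal prime
(the Jacobian scheme is irreducible). -/
theorem minorIdeal_isPrime_of_threeConnected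
    (W : Submodule K (E → K)) {r : ℕ} (w : Fin r → E → K)
    (hw : IsBasisOf w W) (h3 : ThreeConnected W) (hrk : 2 ≤ r) :
    (minorIdeal w).IsPrime ∧ ∃! P : Ideal (MvPolynomial E K), P ∈ (jacIdeal w).minimalPrimes := by
  obtain ⟨n, rfl⟩ : ∃ n, r = n + 1 := ⟨r - 1, by omega⟩
  exact final_aux w hw h3 (by omega)

end Config
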